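/- Fix B > 0. There is a constant C such that: if w ∈ C^∞(ℝ×ℝ³) satisfies w(t,x)=0 for t ≤ 2B and □w(t,x)=0 for |x| > t−B, then for all t ≥ 2B, (1+t) sup_x |∂_{t,x} w(t,x)| ≤ C Σ_{|α|≤2} Σ_{k∈ℤ} sup_{τ∈[2^{k−1},2^{k+1}]∩[2B,t]} 2^k ‖Γ^α □w(τ,·)‖_{L²(ℝ³)}. -/

import Mathlib

open MeasureTheory

noncomputable section

/-- The partial derivative in the `i`-th coordinate direction on `ℝⁿ`. -/
def pd {n : ℕ} (i : Fin n) (u : (Fin n → ℝ) → ℝ) : (Fin n → ℝ) → ℝ :=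
  fun z => fderiv ℝ u z (Pi.single i 1)

/-- Iterated application of a family of first-order operators along a list of indices. -/
def opIter {α γ : Type*} (F : α → γ → γ) : List α → γ → γ
  | [] => id
  | i :: L => fun u => F i (opIter F L u)

/-- The ten vector fields Γ on ℝ×ℝ³ (coordinates: `0 = t`, `1,2,3 = x`):
`∂_t, ∂_{x₁}, ∂_{x₂}, ∂_{x₃}`, the rotations `Ω_{jk} = x_j∂_k - x_k∂_j` (`1 ≤ j < k ≤ 3`)
and the boosts `Ω_{0k} = x_k∂_t + t∂_k` (`k = 1,2,3`). -/
def GammaField (i : Fin 10) (u : (Fin 4 → ℝ) → ℝ) : (Fin 4 → ℝ) → ℝ :=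
  if i.val = 0 then pd 0 u
  else if i.val = 1 then pd 1 u
  else if i.val = 2 then pd 2 u
  else if i.val = 3 then pd 3 u
  else if i.val = 4 then fun z => z 1 * pd 2 u z - z 2 * pd 1 u z
  else if i.val = 5 then fun z => z 1 * pd 3 u z - z 3 * pd 1 u z
  else if i.val = 6 then fun z => z 2 * pd 3 u z - z 3 * pd 2 u z
  else if i.val = 7 then fun z => z 1 * pd 0 u z + z 0 * pd 1 u z
  else if i.val = 8 then fun z => z 2 * pd 0 u z + z 0 * pd 2 u z
  else fun z => z 3 * pd 0 u z + z 0 * pd 3 u z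

/-- The spatial radius `r = |x|` of a space-time point. -/
def rad (z : Fin 4 → ℝ) : ℝ := Real.sqrt ((z 1)^2 + (z 2)^2 + (z 3)^2)

/-- The d'Alembertian `□ = ∂_t² - Δ` on ℝ×ℝ³. -/
def Box (u : (Fin 4 → ℝ) → ℝ) : (Fin 4 → ℝ) → ℝ :=
  fun z => pd 0 (pd 0 u) z - pd 1 (pd 1 u) z - pd 2 (pd 2 u) z - pd 3 (pd 3 u) z

/-- The `L²` norm in `x ∈ ℝ³` at fixed time `t`. -/
def L2x (f : (Fin 4 → ℝ) → ℝ) (t : ℝ) : ℝ :=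
  Real.sqrt (∫ x : Fin 3 → ℝ, (f (Fin.cons t x))^2)

/-- The dyadic sum `Σ_k sup_{τ ∈ [2^{k-1},2^{k+1}] ∩ [2B,t]} 2^k g(τ)`; for each `k ∈ ℤ` the
supremum is taken over the (possibly empty) intersection, and `sSup ∅ = 0` in `ℝ`. -/
def dyadic (g : ℝ → ℝ) (B t : ℝ) : ℝ :=
  ∑' k : ℤ, sSup ((fun τ => (2:ℝ)^k * g τ) ''
    (Set.Icc ((2:ℝ)^(k-1)) ((2:ℝ)^(k+1)) ∩ Set.Icc (2*B) t))

/-- Smoothness of a real function on `ℝⁿ`. -/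
abbrev Smooth {n : ℕ} (u : (Fin n → ℝ) → ℝ) : Prop := ContDiff ℝ (⊤ : ℕ∞) u

theorem Smooth.differentiable {n : ℕ} {u : (Fin n → ℝ) → ℝ} (hu : Smooth u) :
    Differentiable ℝ u := ContDiff.differentiable hu (by simp)

theorem Smooth.pd {n : ℕ} {u : (Fin n → ℝ) → ℝ} (hu : Smooth u) (i : Fin n) :
    Smooth (pd i u) :=
  (ContDiff.fderiv_right hu (by simp)).clm_apply contDiff_const

theorem pd_comm {n : ℕ} {u : (Fin n → ℝ) → ℝ} (hu : Smooth u) (i j : Fin n) :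
    pd i (pd j u) = pd j (pd i u) := by
  have hd : Differentiable ℝ (fderiv ℝ u) :=
    (ContDiff.fderiv_right (m := 1) hu (by norm_cast)).differentiable (by simp)
  have key : ∀ (k l : Fin n) (z : Fin n → ℝ), pd k (pd l u) z =
      fderiv ℝ (fderiv ℝ u) z (Pi.single k 1) (Pi.single l 1) := by
    intro k l z
    have : HasFDerivAt (fun z => fderiv ℝ u z (Pi.single l 1))
        ((fderiv ℝ (fderiv ℝ u) z).flip (Pi.single l (1:ℝ))) z := by
      simpa using (hd z).hasFDerivAt.clm_apply (hasFDerivAt_const (Pi.single l (1:ℝ)) z)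
    unfold pd
    rw [this.fderiv]
    rfl
  funext z
  rw [key, key]
  exact (ContDiff.contDiffAt hu).isSymmSndFDerivAt (by simp; norm_cast) _ _

theorem pd_add {n : ℕ} {u v : (Fin n → ℝ) → ℝ} (hu : Smooth u) (hv : Smooth v) (i : Fin n) :
    pd i (fun z => u z + v z) = fun z => pd i u z + pd i v z := by
  funext z
  simp only [pd]
  rw [fderiv_fun_add (hu.differentiable z) (hv.differentiable z)]
  rfl

theorem pd_sub {n : ℕ} {u v : (Fin n → ℝ) → ℝ} (hu : Smooth u) (hv : Smooth v) (i : Fin n) :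
    pd i (fun z => u z - v z) = fun z => pd i u z - pd i v z := by
  funext z
  simp only [pd]
  rw [fderiv_fun_sub (hu.differentiable z) (hv.differentiable z)]
  rfl

theorem pd_coord_mul {n : ℕ} {u : (Fin n → ℝ) → ℝ} (hu : Smooth u) (i j : Fin n) :
    pd i (fun z => z j * u z) = fun z => (if i = j then 1 else 0) * u z + z j * pd i u z := by
  funext z
  have h := (hasFDerivAt_apply (𝕜 := ℝ) j z).mul (hu.differentiable z).hasFDerivAt
  simp only [pd]
  rw [show (fun z : Fin n → ℝ => z j * u z) = (fun z => z j) * u from rfl, h.fderiv]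
  by_cases hij : i = j
  · subst hij; simp; ring
  · simp [hij, Ne.symm hij]

theorem smooth_coord {n : ℕ} (j : Fin n) : Smooth (fun z : Fin n → ℝ => z j) :=
  contDiff_apply ℝ ℝ j

theorem Smooth.coord_mul {n : ℕ} {u : (Fin n → ℝ) → ℝ} (hu : Smooth u) (j : Fin n) :
    Smooth (fun z => z j * u z) := (smooth_coord j).mul hu

theorem Smooth.box {u : (Fin 4 → ℝ) → ℝ} (hu : Smooth u) : Smooth (Box u) :=
  (((((hu.pd 0).pd 0).sub ((hu.pd 1).pd 1)).sub ((hu.pd 2).pd 2)).sub ((hu.pd 3).pd 3))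

theorem Smooth.gammaField {u : (Fin 4 → ℝ) → ℝ} (hu : Smooth u) (i : Fin 10) :
    Smooth (GammaField i u) := by
  have hr : ∀ j k : Fin 4, Smooth (fun z => z j * _root_.pd k u z - z k * _root_.pd j u z) :=
    fun j k => ((hu.pd k).coord_mul j).sub ((hu.pd j).coord_mul k)
  have hb : ∀ k : Fin 4, Smooth (fun z => z k * _root_.pd 0 u z + z 0 * _root_.pd k u z) :=
    fun k => ((hu.pd 0).coord_mul k).add ((hu.pd k).coord_mul 0)
  fin_cases i
  exacts [hu.pd 0, hu.pd 1, hu.pd 2, hu.pd 3, hr 1 2, hr 1 3, hr 2 3, hb 1, hb 2, hb 3]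

theorem Smooth.opIter {u : (Fin 4 → ℝ) → ℝ} (hu : Smooth u) (L : List (Fin 10)) :
    Smooth (opIter GammaField L u) := by
  induction L with
  | nil => exact hu
  | cons i L ih => exact ih.gammaField i

/-- Second derivative of a first-order operator with linear coefficients. -/
theorem pd_pd_coord_mul {n : ℕ} {u : (Fin n → ℝ) → ℝ} (hu : Smooth u) (i j : Fin n) :
    pd i (pd i (fun z => z j * u z)) =
      fun z => 2 * (if i = j then 1 else 0) * pd i u z + z j * pd i (pd i u) z := by
  rw [pd_coord_mul hu]
  by_cases hij : i = j
  · simp only [hij, if_true, one_mul]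
    rw [pd_add hu ((hu.pd j).coord_mul j), pd_coord_mul (hu.pd j)]
    funext z
    simp
    ring
  · simp only [hij, if_false, zero_mul, zero_add, mul_zero]
    rw [pd_coord_mul (hu.pd i)]
    simp [hij]

theorem box_coord_mul {u : (Fin 4 → ℝ) → ℝ} (hu : Smooth u) (j : Fin 4) (z : Fin 4 → ℝ) :
    Box (fun z => z j * u z) z =
      (if j = 0 then 2 else -2) * pd j u z + z j * Box u z := by
  unfold Box
  simp only [pd_pd_coord_mul hu]
  fin_cases j <;> simp <;> ring

theorem box_pd {u : (Fin 4 → ℝ) → ℝ} (hu : Smooth u) (j : Fin 4) :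
    Box (pd j u) = pd j (Box u) := by
  have h : ∀ i, Smooth (pd i (pd i u)) := fun i => (hu.pd i).pd i
  unfold Box
  rw [pd_sub (((h 0).sub (h 1)).sub (h 2)) (h 3), pd_sub ((h 0).sub (h 1)) (h 2),
    pd_sub (h 0) (h 1)]
  have hc : ∀ i, pd i (pd i (pd j u)) = pd j (pd i (pd i u)) := fun i => by
    rw [pd_comm hu i j, pd_comm (hu.pd i) i j]
  simp only [hc]

theorem box_add {u v : (Fin 4 → ℝ) → ℝ} (hu : Smooth u) (hv : Smooth v) (z : Fin 4 → ℝ) :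
    Box (fun z => u z + v z) z = Box u z + Box v z := by
  unfold Box
  simp only [pd_add hu hv, pd_add (hu.pd _) (hv.pd _)]
  ring

theorem box_sub {u v : (Fin 4 → ℝ) → ℝ} (hu : Smooth u) (hv : Smooth v) (z : Fin 4 → ℝ) :
    Box (fun z => u z - v z) z = Box u z - Box v z := by
  unfold Box
  simp only [pd_sub hu hv, pd_sub (hu.pd _) (hv.pd _)]
  ring

theorem box_gammaField {u : (Fin 4 → ℝ) → ℝ} (hu : Smooth u) (i : Fin 10) :
    Box (GammaField i u) = GammaField i (Box u) := by
  have hr : ∀ j k : Fin 4, j ≠ 0 → k ≠ 0 → Box (fun z => z j * pd k u z - z k * pd j u z) =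
      fun z => z j * pd k (Box u) z - z k * pd j (Box u) z := by
    intro j k hj hk
    funext z
    rw [box_sub ((hu.pd k).coord_mul j) ((hu.pd j).coord_mul k), box_coord_mul (hu.pd k),
      box_coord_mul (hu.pd j), box_pd hu, box_pd hu, pd_comm hu j k]
    simp [hj, hk]
  have hb : ∀ k : Fin 4, k ≠ 0 → Box (fun z => z k * pd 0 u z + z 0 * pd k u z) =
      fun z => z k * pd 0 (Box u) z + z 0 * pd k (Box u) z := by
    intro k hk
    funext z
    rw [box_add ((hu.pd 0).coord_mul k) ((hu.pd k).coord_mul 0), box_coord_mul (hu.pd k),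
      box_coord_mul (hu.pd 0), box_pd hu, box_pd hu, pd_comm hu k 0]
    simp [hk]
    ring
  fin_cases i
  exacts [box_pd hu 0, box_pd hu 1, box_pd hu 2, box_pd hu 3, hr 1 2 (by decide) (by decide),
    hr 1 3 (by decide) (by decide), hr 2 3 (by decide) (by decide), hb 1 (by decide),
    hb 2 (by decide), hb 3 (by decide)]

theorem box_opIter {u : (Fin 4 → ℝ) → ℝ} (hu : Smooth u) (L : List (Fin 10)) :
    Box (opIter GammaField L u) = opIter GammaField L (Box u) := by
  induction L with
  | nil => rfl
  | cons i L ih =>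
    change Box (GammaField i (opIter GammaField L u)) = GammaField i (opIter GammaField L (Box u))
    rw [box_gammaField (hu.opIter L), ih]

/-- `GammaField` is a first-order differential operator without zeroth order term. -/
theorem gammaField_eq_zero {u : (Fin 4 → ℝ) → ℝ} {z : Fin 4 → ℝ} (h : ∀ j, pd j u z = 0)
    (i : Fin 10) : GammaField i u z = 0 := by
  fin_cases i <;> simp [GammaField, h]

theorem pd_eq_zero_of_isOpen {n : ℕ} {u : (Fin n → ℝ) → ℝ} {s : Set (Fin n → ℝ)} (hs : IsOpen s)
    (h : ∀ z ∈ s, u z = 0) (j : Fin n) : ∀ z ∈ s, pd j u z = 0 := by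
  intro z hz
  have : u =ᶠ[nhds z] fun _ => 0 := by
    filter_upwards [hs.mem_nhds hz] with y hy using h y hy
  simp [pd, this.fderiv_eq]

theorem opIter_eq_zero_of_isOpen {u : (Fin 4 → ℝ) → ℝ} {s : Set (Fin 4 → ℝ)} (hs : IsOpen s)
    (h : ∀ z ∈ s, u z = 0) (L : List (Fin 10)) : ∀ z ∈ s, opIter GammaField L u z = 0 := by
  induction L with
  | nil => exact h
  | cons i L ih =>
    exact fun z hz => gammaField_eq_zero (fun j => pd_eq_zero_of_isOpen hs ih j z hz) i

theorem pd_eq_zero_of_le {u : (Fin 4 → ℝ) → ℝ} (hu : Smooth u) {c : ℝ}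
    (h : ∀ z : Fin 4 → ℝ, z 0 ≤ c → u z = 0) (j : Fin 4) :
    ∀ z : Fin 4 → ℝ, z 0 ≤ c → pd j u z = 0 := by
  intro z hz
  have hopen : IsOpen {z : Fin 4 → ℝ | z 0 < c} :=
    isOpen_lt (continuous_apply 0) continuous_const
  have h1 := pd_eq_zero_of_isOpen hopen (fun z hz => h z (le_of_lt hz)) j
  have hcont : Continuous (fun s : ℝ => pd j u (z - s • Pi.single 0 1)) :=
    (hu.pd j).continuous.comp (by fun_prop)
  have hlim : Filter.Tendsto (fun s : ℝ => pd j u (z - s • Pi.single 0 1))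
      (nhdsWithin 0 (Set.Ioi 0)) (nhds (pd j u z)) := by
    have := (hcont.tendsto 0).mono_left (nhdsWithin_le_nhds (s := Set.Ioi 0))
    simpa using this
  have hz0 : Filter.Tendsto (fun s : ℝ => pd j u (z - s • Pi.single 0 1))
      (nhdsWithin 0 (Set.Ioi 0)) (nhds 0) := by
    refine tendsto_const_nhds.congr' ?_
    filter_upwards [self_mem_nhdsWithin] with s hs
    refine (h1 _ ?_).symm
    have : 0 < s := hs
    simp
    linarith
  exact tendsto_nhds_unique hlim hz0

theorem opIter_eq_zero_of_le {u : (Fin 4 → ℝ) → ℝ} (hu : Smooth u) {c : ℝ}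
    (h : ∀ z : Fin 4 → ℝ, z 0 ≤ c → u z = 0) (L : List (Fin 10)) :
    ∀ z : Fin 4 → ℝ, z 0 ≤ c → opIter GammaField L u z = 0 := by
  induction L with
  | nil => exact h
  | cons i L ih =>
    exact fun z hz => gammaField_eq_zero (fun j => pd_eq_zero_of_le (hu.opIter L) ih j z hz) i

/-- The Cauchy–Schwarz inequality for square-integrable real functions. -/
theorem sq_integral_mul_le {X : Type*} [MeasurableSpace X] {μ : Measure X} {f g : X → ℝ}
    (hf : Integrable (fun x => f x ^ 2) μ) (hg : Integrable (fun x => g x ^ 2) μ)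
    (hfg : Integrable (fun x => f x * g x) μ) :
    (∫ x, f x * g x ∂μ) ^ 2 ≤ (∫ x, f x ^ 2 ∂μ) * ∫ x, g x ^ 2 ∂μ := by
  have key : ∀ c : ℝ, 0 ≤ (∫ x, g x ^ 2 ∂μ) * (c * c) + (-2 * ∫ x, f x * g x ∂μ) * c
      + ∫ x, f x ^ 2 ∂μ := by
    intro c
    have h0 : 0 ≤ ∫ x, (f x - c * g x) ^ 2 ∂μ := integral_nonneg fun x => sq_nonneg _
    have h1 : ∫ x, (f x - c * g x) ^ 2 ∂μ =
        ∫ x, ((c * c) * g x ^ 2 + (-2 * c) * (f x * g x) + f x ^ 2) ∂μ :=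
      integral_congr_ae (Filter.Eventually.of_forall fun x => by ring)
    rw [h1, integral_add ((hg.const_mul _).fun_add (hfg.const_mul _)) hf,
      integral_add (hg.const_mul _) (hfg.const_mul _), integral_const_mul,
      integral_const_mul] at h0
    linarith
  have := discrim_le_zero key
  unfold discrim at this
  nlinarith

theorem volume_unit_cube : volume (Set.Icc (0 : Fin 3 → ℝ) 1) = 1 := by
  rw [Real.volume_Icc_pi]
  simp

/-- Averages over the cube with corner `p` and side `ρ` are controlled by the `L²` norm over a
larger cube. -/
theorem cube_average_le {g : (Fin 3 → ℝ) → ℝ} (hg : Continuous g) (p : Fin 3 → ℝ) {ρ R N : ℝ}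
    (hρ : 0 < ρ) (hρR : ρ ≤ R) (hN : 0 ≤ N)
    (h : ∫ y in Set.Icc p (fun i => p i + R), g y ^ 2 ≤ N ^ 2) :
    ∫ z in Set.Icc (0 : Fin 3 → ℝ) 1, g (p + ρ • z) ≤ ρ ^ (-(3 / 2) : ℝ) * N := by
  have hc : Continuous fun z : Fin 3 → ℝ => g (p + ρ • z) := by fun_prop
  have hK : IsCompact (Set.Icc (0 : Fin 3 → ℝ) 1) := isCompact_Icc
  have hCS := sq_integral_mul_le (μ := volume.restrict (Set.Icc (0 : Fin 3 → ℝ) 1))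
    (f := fun _ => 1) (g := fun z => g (p + ρ • z))
    (continuous_const.continuousOn.integrableOn_compact hK)
    ((hc.pow 2).continuousOn.integrableOn_compact hK)
    ((continuous_const.mul hc).continuousOn.integrableOn_compact hK)
  have hone : ∫ _ in Set.Icc (0 : Fin 3 → ℝ) 1, ((1 : ℝ) ^ 2) = 1 := by
    simp [Measure.real, volume_unit_cube]
  rw [hone] at hCS
  simp only [one_mul] at hCS
  have hB : MeasurableSet (Set.Icc p (fun i => p i + R)) := measurableSet_Icc
  have hfi : Integrable ((Set.Icc p (fun i => p i + R)).indicator fun y => g y ^ 2) :=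
    ((hg.pow 2).continuousOn.integrableOn_compact isCompact_Icc).integrable_indicator hB
  have hle : ∫ z in Set.Icc (0 : Fin 3 → ℝ) 1, g (p + ρ • z) ^ 2 ≤ (ρ ^ 3)⁻¹ * N ^ 2 := by
    set I := (Set.Icc p (fun i => p i + R)).indicator fun y => g y ^ 2 with hI
    have hInn : ∀ y, 0 ≤ I y := fun y => Set.indicator_nonneg (fun _ _ => sq_nonneg _) y
    have hint2 : Integrable fun z : Fin 3 → ℝ => I (p + ρ • z) :=
      (hfi.comp_add_left p).comp_smul hρ.ne'
    calc ∫ z in Set.Icc (0 : Fin 3 → ℝ) 1, g (p + ρ • z) ^ 2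
        = ∫ z in Set.Icc (0 : Fin 3 → ℝ) 1, I (p + ρ • z) := by
          refine setIntegral_congr_fun measurableSet_Icc fun z hz => ?_
          have hmem : p + ρ • z ∈ Set.Icc p (fun i => p i + R) := by
            constructor
            · intro i
              have := hz.1 i
              have h2 : 0 ≤ ρ * z i := mul_nonneg hρ.le this
              simpa using h2
            · intro i
              have h1 := hz.1 i
              have h2 := hz.2 i
              simp at h1 h2
              simp
              nlinarith
          simp [hI, Set.indicator_of_mem hmem]
      _ ≤ ∫ z, I (p + ρ • z) :=
          setIntegral_le_integral hint2 (Filter.Eventually.of_forall fun z => hInn _)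
      _ = (ρ ^ 3)⁻¹ * ∫ y, I (p + y) := by
          rw [Measure.integral_comp_smul volume (fun y => I (p + y)) ρ]
          simp [abs_of_pos hρ]
      _ = (ρ ^ 3)⁻¹ * ∫ y in Set.Icc p (fun i => p i + R), g y ^ 2 := by
          rw [integral_add_left_eq_self, hI, integral_indicator hB]
      _ ≤ _ := by gcongr
  refine abs_le_of_sq_le_sq' ?_ (by positivity) |>.2
  refine (hCS.trans hle).trans_eq ?_
  rw [mul_pow, ← Real.rpow_natCast (ρ ^ (-(3 / 2) : ℝ)) 2, ← Real.rpow_mul hρ.le,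
    ← Real.rpow_natCast ρ 3, ← Real.rpow_neg hρ.le]
  norm_num

theorem hasDerivAt_comp_line {n : ℕ} {u : (Fin n → ℝ) → ℝ} (hu : Smooth u) (p z : Fin n → ℝ)
    (s : ℝ) : HasDerivAt (fun s : ℝ => u (p + s • z)) (∑ i, z i * pd i u (p + s • z)) s := by
  have h1 : HasDerivAt (fun s : ℝ => p + s • z) z s := by
    simpa using ((hasDerivAt_id s).smul_const z).const_add p
  have h2 := (hu.differentiable (p + s • z)).hasFDerivAt.comp_hasDerivAt s h1
  refine HasDerivAt.congr_deriv (f := fun s : ℝ => u (p + s • z)) h2 (Eq.symm ?_)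
  have hz : z = ∑ i, z i • Pi.single i (1 : ℝ) := by
    funext j
    simp [Finset.sum_apply, Pi.single_apply]
  calc ∑ i, z i * pd i u (p + s • z)
      = fderiv ℝ u (p + s • z) (∑ i, z i • Pi.single i (1 : ℝ)) := by
        rw [map_sum]; simp [pd]
    _ = _ := by rw [← hz]

theorem integral_swap_of_continuous {f : ℝ → (Fin 3 → ℝ) → ℝ} (hf : Continuous (Function.uncurry f))
    {K : Set (Fin 3 → ℝ)} (hK : IsCompact K) {a b : ℝ} (hab : a ≤ b) :
    ∫ z in K, ∫ s in a..b, f s z = ∫ s in a..b, ∫ z in K, f s z := by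
  simp only [intervalIntegral.integral_of_le hab]
  refine integral_integral_swap ?_
  rw [Measure.prod_restrict]
  refine IntegrableOn.mono_set (t := K ×ˢ Set.Icc a b) ?_
    (Set.prod_mono le_rfl Set.Ioc_subset_Icc_self)
  refine ContinuousOn.integrableOn_compact (hK.prod isCompact_Icc) ?_
  exact (hf.comp continuous_swap).continuousOn

/-- Pointwise bound of a smooth function by its values and derivatives along a ray. -/
theorem abs_le_of_ray {V : (Fin 3 → ℝ) → ℝ} (hV : Smooth V) (p z : Fin 3 → ℝ)
    (hz : z ∈ Set.Icc (0 : Fin 3 → ℝ) 1) {a R : ℝ} (ha : 0 < a) (haR : a ≤ R) :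
    |V p| ≤ |V (p + R • z)| + a * ∑ i, |pd i V (p + a • z)|
      + (∫ s in a..R, ∑ i, |pd i V (p + s • z)|)
      + ∫ s in (0:ℝ)..a, s * ∑ i, ∑ j, |pd j (pd i V) (p + s • z)| := by
  have hz1 : ∀ i, |z i| ≤ 1 := fun i => by
    rw [abs_of_nonneg (hz.1 i)]; exact hz.2 i
  have hc1 : ∀ i, Continuous fun s : ℝ => pd i V (p + s • z) := fun i =>
    (hV.pd i).continuous.comp (by fun_prop)
  have hc2 : ∀ i j, Continuous fun s : ℝ => pd j (pd i V) (p + s • z) := fun i j =>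
    ((hV.pd i).pd j).continuous.comp (by fun_prop)
  set f1 : ℝ → ℝ := fun s => ∑ i, z i * pd i V (p + s • z) with hf1
  set f2 : ℝ → ℝ := fun s => ∑ i, z i * ∑ j, z j * pd j (pd i V) (p + s • z) with hf2
  have hcf1 : Continuous f1 := continuous_finsetSum _ fun i _ => continuous_const.mul (hc1 i)
  have hcf2 : Continuous f2 := continuous_finsetSum _ fun i _ => continuous_const.mul
    (continuous_finsetSum _ fun j _ => continuous_const.mul (hc2 i j))
  have hd1 : ∀ s, HasDerivAt f1 (f2 s) s := fun s =>
    HasDerivAt.fun_sum fun i _ => (hasDerivAt_comp_line (hV.pd i) p z s).const_mul (z i)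
  have e1 : ∫ s in a..R, f1 s = V (p + R • z) - V (p + a • z) :=
    intervalIntegral.integral_eq_sub_of_hasDerivAt (fun s _ => hasDerivAt_comp_line hV p z s)
      (hcf1.intervalIntegrable _ _)
  have e2 : ∫ s in (0:ℝ)..a, s * f2 s = (a * f1 a - V (p + a • z)) -
      (0 * f1 0 - V (p + (0:ℝ) • z)) :=
    intervalIntegral.integral_eq_sub_of_hasDerivAt (f := fun s => s * f1 s - V (p + s • z))
      (fun s _ => by
        have := ((hasDerivAt_id s).mul (hd1 s)).sub (hasDerivAt_comp_line hV p z s)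
        refine this.congr_deriv ?_
        simp [hf1])
      ((continuous_id.mul hcf2).intervalIntegrable _ _)
  have b1 : ∀ s, |f1 s| ≤ ∑ i, |pd i V (p + s • z)| := fun s => by
    refine (Finset.abs_sum_le_sum_abs _ _).trans (Finset.sum_le_sum fun i _ => ?_)
    rw [abs_mul]
    exact mul_le_of_le_one_left (abs_nonneg _) (hz1 i)
  have b2 : ∀ s, |f2 s| ≤ ∑ i, ∑ j, |pd j (pd i V) (p + s • z)| := fun s => by
    refine (Finset.abs_sum_le_sum_abs _ _).trans (Finset.sum_le_sum fun i _ => ?_)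
    rw [abs_mul]
    refine (mul_le_of_le_one_left (abs_nonneg _) (hz1 i)).trans ?_
    refine (Finset.abs_sum_le_sum_abs _ _).trans (Finset.sum_le_sum fun j _ => ?_)
    rw [abs_mul]
    exact mul_le_of_le_one_left (abs_nonneg _) (hz1 j)
  have i1 : |∫ s in a..R, f1 s| ≤ ∫ s in a..R, ∑ i, |pd i V (p + s • z)| :=
    (intervalIntegral.abs_integral_le_integral_abs haR).trans
      (intervalIntegral.integral_mono_on haR (hcf1.abs.intervalIntegrable _ _)
        ((continuous_finsetSum _ fun i _ => (hc1 i).abs).intervalIntegrable _ _)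
        fun s _ => b1 s)
  have i2 : |∫ s in (0:ℝ)..a, s * f2 s| ≤
      ∫ s in (0:ℝ)..a, s * ∑ i, ∑ j, |pd j (pd i V) (p + s • z)| :=
    (intervalIntegral.abs_integral_le_integral_abs ha.le).trans
      (intervalIntegral.integral_mono_on ha.le
        ((continuous_id.mul hcf2).abs.intervalIntegrable _ _)
        ((continuous_id.mul (continuous_finsetSum _ fun i _ =>
          continuous_finsetSum _ fun j _ => (hc2 i j).abs)).intervalIntegrable _ _)
        fun s hs => by
          rw [abs_mul, abs_of_nonneg hs.1]
          exact mul_le_mul_of_nonneg_left (b2 s) hs.1)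
  have hV0 : V p = V (p + R • z) - a * f1 a - (∫ s in a..R, f1 s) + ∫ s in (0:ℝ)..a, s * f2 s := by
    rw [e1, e2]; simp; ring
  have i3 : |a * f1 a| ≤ a * ∑ i, |pd i V (p + a • z)| := by
    rw [abs_mul, abs_of_pos ha]
    exact mul_le_mul_of_nonneg_left (b1 a) ha.le
  rw [hV0]
  refine (abs_add_le _ _).trans (add_le_add ((abs_sub _ _).trans (add_le_add
    ((abs_sub _ _).trans (add_le_add le_rfl i3)) i1)) i2)

/-- A Sobolev inequality on a cube in `ℝ³`, keeping track of scales. -/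
theorem sobolev_cube {V : (Fin 3 → ℝ) → ℝ} (hV : Smooth V) (p : Fin 3 → ℝ) {a R N₀ N₁ N₂ : ℝ}
    (ha : 0 < a) (haR : a ≤ R) (hN₀ : 0 ≤ N₀) (hN₁ : 0 ≤ N₁) (hN₂ : 0 ≤ N₂)
    (h₀ : ∫ y in Set.Icc p (fun i => p i + R), |V y| ^ 2 ≤ N₀ ^ 2)
    (h₁ : ∫ y in Set.Icc p (fun i => p i + R), (∑ i, |pd i V y|) ^ 2 ≤ N₁ ^ 2)
    (h₂ : ∫ y in Set.Icc p (fun i => p i + R), (∑ i, ∑ j, |pd j (pd i V) y|) ^ 2 ≤ N₂ ^ 2) :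
    |V p| ≤ R ^ (-(3 / 2) : ℝ) * N₀ + 3 * a ^ (-(1 / 2) : ℝ) * N₁ + 2 * a ^ (1 / 2 : ℝ) * N₂ := by
  have hR : 0 < R := ha.trans_le haR
  have hK : IsCompact (Set.Icc (0 : Fin 3 → ℝ) 1) := isCompact_Icc
  set G1 : (Fin 3 → ℝ) → ℝ := fun y => ∑ i, |pd i V y| with hG1
  set G2 : (Fin 3 → ℝ) → ℝ := fun y => ∑ i, ∑ j, |pd j (pd i V) y| with hG2
  have cV : Continuous fun y => |V y| := hV.continuous.abs
  have c1 : Continuous G1 := continuous_finsetSum _ fun i _ => (hV.pd i).continuous.abs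
  have c2 : Continuous G2 := continuous_finsetSum _ fun i _ =>
    continuous_finsetSum _ fun j _ => ((hV.pd i).pd j).continuous.abs
  have c1' : Continuous (Function.uncurry fun (s : ℝ) (z : Fin 3 → ℝ) => G1 (p + s • z)) :=
    c1.comp (by fun_prop)
  have c2' : Continuous (Function.uncurry fun (s : ℝ) (z : Fin 3 → ℝ) => s * G2 (p + s • z)) :=
    continuous_fst.mul (c2.comp (by fun_prop))
  have m0 : Continuous fun z : Fin 3 → ℝ => |V (p + R • z)| := cV.comp (by fun_prop)
  have m1 : Continuous fun z : Fin 3 → ℝ => a * G1 (p + a • z) :=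
    continuous_const.mul (c1.comp (by fun_prop))
  have m2 : Continuous fun z : Fin 3 → ℝ => ∫ s in a..R, G1 (p + s • z) :=
    intervalIntegral.continuous_parametric_intervalIntegral_of_continuous'
      (f := fun z s => G1 (p + s • z)) (c1'.comp continuous_swap) _ _
  have m3 : Continuous fun z : Fin 3 → ℝ => ∫ s in (0:ℝ)..a, s * G2 (p + s • z) :=
    intervalIntegral.continuous_parametric_intervalIntegral_of_continuous'
      (f := fun z s => s * G2 (p + s • z)) (c2'.comp continuous_swap) _ _
  have I : ∀ {g : (Fin 3 → ℝ) → ℝ}, Continuous g → IntegrableOn g (Set.Icc 0 1) :=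
    fun hg => hg.continuousOn.integrableOn_compact hK
  have hmono : ∫ _ in Set.Icc (0 : Fin 3 → ℝ) 1, |V p| ≤
      ∫ z in Set.Icc (0 : Fin 3 → ℝ) 1, (|V (p + R • z)| + a * G1 (p + a • z)
        + (∫ s in a..R, G1 (p + s • z)) + ∫ s in (0:ℝ)..a, s * G2 (p + s • z)) :=
    setIntegral_mono_on (I continuous_const) (I (((m0.add m1).add m2).add m3))
      measurableSet_Icc fun z hz => abs_le_of_ray hV p z hz ha haR
  rw [integral_add (I ((m0.fun_add m1).fun_add m2)) (I m3), integral_add (I (m0.fun_add m1)) (I m2),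
    integral_add (I m0) (I m1), integral_swap_of_continuous c1' hK haR,
    integral_swap_of_continuous c2' hK ha.le, integral_const_mul] at hmono
  have hleft : ∫ _ in Set.Icc (0 : Fin 3 → ℝ) 1, |V p| = |V p| := by
    simp [Measure.real, volume_unit_cube]
  rw [hleft] at hmono
  have t0 := cube_average_le cV p hR le_rfl hN₀ h₀
  have t1 : a * ∫ z in Set.Icc (0 : Fin 3 → ℝ) 1, G1 (p + a • z) ≤ a ^ (-(1 / 2) : ℝ) * N₁ := by
    refine (mul_le_mul_of_nonneg_left (cube_average_le c1 p ha haR hN₁ h₁) ha.le).trans_eq ?_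
    rw [← mul_assoc, ← Real.rpow_one_add' ha.le (by norm_num)]
    norm_num
  have hcav1 : Continuous fun s : ℝ => ∫ z in Set.Icc (0 : Fin 3 → ℝ) 1, G1 (p + s • z) :=
    continuous_parametric_integral_of_continuous c1' hK
  have hcav2 : Continuous fun s : ℝ => ∫ z in Set.Icc (0 : Fin 3 → ℝ) 1, s * G2 (p + s • z) :=
    continuous_parametric_integral_of_continuous c2' hK
  have ne : (0:ℝ) ∉ Set.uIcc a R := by
    rw [Set.uIcc_of_le haR]; exact fun h => absurd h.1 (not_le.2 ha)
  have t2 : ∫ s in a..R, ∫ z in Set.Icc (0 : Fin 3 → ℝ) 1, G1 (p + s • z) ≤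
      2 * a ^ (-(1 / 2) : ℝ) * N₁ := by
    have hle : ∫ s in a..R, ∫ z in Set.Icc (0 : Fin 3 → ℝ) 1, G1 (p + s • z) ≤
        ∫ s in a..R, s ^ (-(3 / 2) : ℝ) * N₁ :=
      intervalIntegral.integral_mono_on haR (hcav1.intervalIntegrable _ _)
        ((intervalIntegral.intervalIntegrable_rpow (Or.inr ne)).mul_const _)
        fun s hs => cube_average_le c1 p (ha.trans_le hs.1) hs.2 hN₁ h₁
    rw [intervalIntegral.integral_mul_const,
      integral_rpow (Or.inr ⟨by norm_num, ne⟩)] at hle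
    refine hle.trans (mul_le_mul_of_nonneg_right ?_ hN₁)
    have : 0 ≤ R ^ (-(1 / 2) : ℝ) := by positivity
    norm_num at this ⊢
    linarith
  have t3 : ∫ s in (0:ℝ)..a, ∫ z in Set.Icc (0 : Fin 3 → ℝ) 1, s * G2 (p + s • z) ≤
      2 * a ^ (1 / 2 : ℝ) * N₂ := by
    have hle : ∫ s in (0:ℝ)..a, ∫ z in Set.Icc (0 : Fin 3 → ℝ) 1, s * G2 (p + s • z) ≤
        ∫ s in (0:ℝ)..a, s ^ (-(1 / 2) : ℝ) * N₂ := by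
      refine intervalIntegral.integral_mono_on_of_le_Ioo ha.le (hcav2.intervalIntegrable _ _)
        ((intervalIntegral.intervalIntegrable_rpow' (by norm_num)).mul_const _) fun s hs => ?_
      rw [integral_const_mul]
      refine (mul_le_mul_of_nonneg_left
        (cube_average_le c2 p hs.1 (hs.2.le.trans haR) hN₂ h₂) hs.1.le).trans_eq ?_
      rw [← mul_assoc, ← Real.rpow_one_add' hs.1.le (by norm_num)]
      norm_num
    rw [intervalIntegral.integral_mul_const, integral_rpow (Or.inl (by norm_num))] at hle
    refine hle.trans (mul_le_mul_of_nonneg_right ?_ hN₂)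
    norm_num
    linarith
  linarith

theorem pd_mul {n : ℕ} {u v : (Fin n → ℝ) → ℝ} {z : Fin n → ℝ} (hu : DifferentiableAt ℝ u z)
    (hv : DifferentiableAt ℝ v z) (i : Fin n) :
    pd i (fun z => u z * v z) z = pd i u z * v z + u z * pd i v z := by
  simp only [pd]
  rw [fderiv_fun_mul hu hv]
  simp
  ring

theorem hasDerivAt_max_zero_sq (s : ℝ) :
    HasDerivAt (fun s : ℝ => max 0 s ^ 2) (2 * max 0 s) s := by
  rcases lt_trichotomy s 0 with h | h | h
  · have : (fun s : ℝ => max 0 s ^ 2) =ᶠ[nhds s] fun _ => 0 := by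
      filter_upwards [Iio_mem_nhds h] with y hy
      simp [max_eq_left (le_of_lt (Set.mem_Iio.1 hy))]
    rw [max_eq_left h.le, mul_zero]
    exact (hasDerivAt_const s 0).congr_of_eventuallyEq this
  · subst h
    rw [max_self, mul_zero, hasDerivAt_iff_isLittleO]
    have h2 : (fun x : ℝ => x ^ 2) =o[nhds 0] fun x : ℝ => x := by
      simpa using Asymptotics.isLittleO_pow_pow (𝕜 := ℝ) (m := 1) (n := 2) (by norm_num)
    refine (Asymptotics.IsBigO.trans_isLittleO (g := fun x : ℝ => x ^ 2) ?_ h2).congr_right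
      (by simp)
    refine Asymptotics.IsBigO.of_bound 1 (Filter.Eventually.of_forall fun x => ?_)
    simp only [max_self, smul_zero, sub_zero, ne_eq, OfNat.ofNat_ne_zero, not_false_eq_true,
      zero_pow, norm_pow, Real.norm_eq_abs, sq_abs, one_mul]
    rcases le_total x 0 with hx | hx
    · rw [max_eq_left hx]; simpa using sq_nonneg x
    · rw [max_eq_right hx]
  · have : (fun s : ℝ => max 0 s ^ 2) =ᶠ[nhds s] fun s => s ^ 2 := by
      filter_upwards [Ioi_mem_nhds h] with y hy
      rw [max_eq_right (le_of_lt hy)]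
    rw [max_eq_right h.le]
    simpa using (hasDerivAt_pow 2 s).congr_of_eventuallyEq this

/-- The defining function of the backward light cone with vertex `(T, 0)`. -/
def coneFun (T : ℝ) (z : Fin 4 → ℝ) : ℝ := (T - z 0) ^ 2 - ((z 1) ^ 2 + (z 2) ^ 2 + (z 3) ^ 2)

/-- A `C¹` weight supported in the backward light cone with vertex `(T, 0)`. -/
def coneWeight (T : ℝ) (z : Fin 4 → ℝ) : ℝ := max 0 (coneFun T z) ^ 2

theorem continuous_coneFun (T : ℝ) : Continuous (coneFun T) := by
  unfold coneFun; fun_prop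

theorem continuous_coneWeight (T : ℝ) : Continuous (coneWeight T) :=
  (continuous_const.max (continuous_coneFun T)).pow 2

theorem coneWeight_nonneg (T : ℝ) (z : Fin 4 → ℝ) : 0 ≤ coneWeight T z := sq_nonneg _

theorem differentiable_coneFun (T : ℝ) : Differentiable ℝ (coneFun T) := by
  unfold coneFun; fun_prop

theorem differentiable_coneWeight (T : ℝ) : Differentiable ℝ (coneWeight T) := fun z =>
  ((hasDerivAt_max_zero_sq _).comp_hasFDerivAt z
    (differentiable_coneFun T z).hasFDerivAt).differentiableAt

theorem pd_coneFun (T : ℝ) (μ : Fin 4) (z : Fin 4 → ℝ) :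
    pd μ (coneFun T) z = -2 * (if μ = 0 then T - z 0 else z μ) := by
  have h0 : HasFDerivAt (fun z : Fin 4 → ℝ => T - z 0)
      (-(ContinuousLinearMap.proj (R := ℝ) (φ := fun _ : Fin 4 => ℝ) 0)) z :=
    (hasFDerivAt_apply (𝕜 := ℝ) 0 z).const_sub T
  have h : ∀ i : Fin 4, HasFDerivAt (fun z : Fin 4 → ℝ => z i)
      (ContinuousLinearMap.proj (R := ℝ) (φ := fun _ : Fin 4 => ℝ) i) z :=
    fun i => hasFDerivAt_apply (𝕜 := ℝ) i z
  have := (h0.pow 2).sub ((((h 1).pow 2).add ((h 2).pow 2)).add ((h 3).pow 2))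
  have e : pd μ (coneFun T) z = _ := congrArg (fun l => l (Pi.single μ (1:ℝ))) this.fderiv
  rw [e]
  fin_cases μ <;> simp

theorem pd_coneWeight (T : ℝ) (μ : Fin 4) (z : Fin 4 → ℝ) :
    pd μ (coneWeight T) z = -4 * max 0 (coneFun T z) * (if μ = 0 then T - z 0 else z μ) := by
  have h := (hasDerivAt_max_zero_sq _).comp_hasFDerivAt z
    (differentiable_coneFun T z).hasFDerivAt
  have e : pd μ (coneWeight T) z = _ := congrArg (fun l => l (Pi.single μ (1:ℝ))) h.fderiv
  have e2 := pd_coneFun T μ z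
  simp only [pd] at e2
  rw [e]
  simp only [_root_.smul_apply, smul_eq_mul, e2]
  ring

/-- The energy current of `u`. -/
def current (u : (Fin 4 → ℝ) → ℝ) (μ : Fin 4) (z : Fin 4 → ℝ) : ℝ :=
  if μ = 0 then ((pd 0 u z) ^ 2 + (pd 1 u z) ^ 2 + (pd 2 u z) ^ 2 + (pd 3 u z) ^ 2) / 2
  else -(pd 0 u z * pd μ u z)

theorem Smooth.current {u : (Fin 4 → ℝ) → ℝ} (hu : Smooth u) (μ : Fin 4) :
    Smooth (current u μ) := by
  unfold _root_.current
  by_cases h : μ = 0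
  · simp only [h, if_true]
    exact (((((hu.pd 0).pow 2).add ((hu.pd 1).pow 2)).add ((hu.pd 2).pow 2)).add
      ((hu.pd 3).pow 2)).div_const 2
  · simp only [h, if_false]
    exact ((hu.pd 0).mul (hu.pd μ)).neg

theorem sum_pd_current {u : (Fin 4 → ℝ) → ℝ} (hu : Smooth u) (z : Fin 4 → ℝ) :
    ∑ μ, pd μ (current u μ) z = pd 0 u z * Box u z := by
  have hd : ∀ i, HasFDerivAt (pd i u) (fderiv ℝ (pd i u) z) z :=
    fun i => ((hu.pd i).differentiable z).hasFDerivAt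
  have h0 : pd 0 (current u 0) z = pd 0 u z * pd 0 (pd 0 u) z + pd 1 u z * pd 0 (pd 1 u) z
      + pd 2 u z * pd 0 (pd 2 u) z + pd 3 u z * pd 0 (pd 3 u) z := by
    have := (((((hd 0).pow 2).add ((hd 1).pow 2)).add ((hd 2).pow 2)).add
      ((hd 3).pow 2)).mul_const (2⁻¹ : ℝ)
    have e : pd 0 (fun z => ((pd 0 u z) ^ 2 + (pd 1 u z) ^ 2 + (pd 2 u z) ^ 2
      + (pd 3 u z) ^ 2) * 2⁻¹) z = _ := congrArg (fun l => l (Pi.single 0 (1:ℝ))) this.fderiv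
    have hc : current u 0 = fun z => ((pd 0 u z) ^ 2 + (pd 1 u z) ^ 2 + (pd 2 u z) ^ 2
      + (pd 3 u z) ^ 2) * 2⁻¹ := by
      funext z; simp [current, div_eq_mul_inv]
    rw [hc, e]
    simp [pd]
    ring
  have hi : ∀ i : Fin 4, i ≠ 0 → pd i (current u i) z =
      -(pd i (pd 0 u) z * pd i u z + pd 0 u z * pd i (pd i u) z) := by
    intro i hi
    have := ((hd 0).mul (hd i)).neg
    have e : pd i (fun z => -(pd 0 u z * pd i u z)) z = _ :=
      congrArg (fun l => l (Pi.single i (1:ℝ))) this.fderiv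
    have hc : current u i = fun z => -(pd 0 u z * pd i u z) := by
      funext z; simp [current, hi]
    rw [hc, e]
    simp [pd]
    ring
  rw [Fin.sum_univ_four, h0, hi 1 (by decide), hi 2 (by decide), hi 3 (by decide),
    pd_comm hu 1 0, pd_comm hu 2 0, pd_comm hu 3 0]
  unfold Box
  ring

/-- The energy flux through the backward light cone has a sign. -/
theorem sum_pd_coneWeight_mul_current_nonpos {u : (Fin 4 → ℝ) → ℝ} {T : ℝ} {z : Fin 4 → ℝ}
    (hz : z 0 ≤ T) : ∑ μ, pd μ (coneWeight T) z * current u μ z ≤ 0 := by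
  simp only [pd_coneWeight, Fin.sum_univ_four, current]
  simp only [if_true, show (1 : Fin 4) ≠ 0 by decide, show (2 : Fin 4) ≠ 0 by decide,
    show (3 : Fin 4) ≠ 0 by decide, if_false]
  set m := max 0 (coneFun T z) with hm
  rcases le_or_gt (coneFun T z) 0 with h | h
  · simp [hm, max_eq_left h]
  have hm0 : 0 ≤ m := le_max_left _ _
  set a := T - z 0
  have ha : 0 ≤ a := by simpa [a] using hz
  have hcone : (z 1) ^ 2 + (z 2) ^ 2 + (z 3) ^ 2 ≤ a ^ 2 := by
    unfold coneFun at h; linarith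
  set p0 := pd 0 u z
  set p1 := pd 1 u z
  set p2 := pd 2 u z
  set p3 := pd 3 u z
  have key : p0 * (z 1 * p1 + z 2 * p2 + z 3 * p3) ≤
      a * ((p0 ^ 2 + p1 ^ 2 + p2 ^ 2 + p3 ^ 2) / 2) := by
    have cs : (z 1 * p1 + z 2 * p2 + z 3 * p3) ^ 2 ≤
        ((z 1) ^ 2 + (z 2) ^ 2 + (z 3) ^ 2) * (p1 ^ 2 + p2 ^ 2 + p3 ^ 2) := by
      nlinarith [sq_nonneg (z 1 * p2 - z 2 * p1), sq_nonneg (z 1 * p3 - z 3 * p1),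
        sq_nonneg (z 2 * p3 - z 3 * p2)]
    have cs2 : (z 1 * p1 + z 2 * p2 + z 3 * p3) ^ 2 ≤ a ^ 2 * (p1 ^ 2 + p2 ^ 2 + p3 ^ 2) :=
      cs.trans (mul_le_mul_of_nonneg_right hcone (by positivity))
    refine abs_le_of_sq_le_sq' ?_ (by positivity) |>.2
    rw [mul_pow, mul_pow]
    calc p0 ^ 2 * (z 1 * p1 + z 2 * p2 + z 3 * p3) ^ 2
        ≤ p0 ^ 2 * (a ^ 2 * (p1 ^ 2 + p2 ^ 2 + p3 ^ 2)) :=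
          mul_le_mul_of_nonneg_left cs2 (sq_nonneg _)
      _ ≤ _ := by
          have : p0 ^ 2 * (p1 ^ 2 + p2 ^ 2 + p3 ^ 2) ≤
              ((p0 ^ 2 + p1 ^ 2 + p2 ^ 2 + p3 ^ 2) / 2) ^ 2 := by
            nlinarith [sq_nonneg (p0 ^ 2 - (p1 ^ 2 + p2 ^ 2 + p3 ^ 2))]
          nlinarith [mul_le_mul_of_nonneg_left this (sq_nonneg a)]
  nlinarith [mul_le_mul_of_nonneg_left key hm0]

/-- Slicing a box integral in space-time by time. -/
theorem integral_Icc_cons {g : (Fin 4 → ℝ) → ℝ} (hg : Continuous g) {c t T : ℝ} (hct : c ≤ t) :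
    ∫ z in Set.Icc (Fin.cons c (fun _ => -T) : Fin 4 → ℝ) (Fin.cons t (fun _ => T)), g z =
      ∫ s in c..t, ∫ y in Set.Icc (fun _ : Fin 3 => -T) (fun _ => T), g (Fin.cons s y) := by
  have hmp := (volume_preserving_piFinSuccAbove (fun _ : Fin 4 => ℝ) 0).symm
  have hsymm : ∀ x : ℝ × (Fin 3 → ℝ), (MeasurableEquiv.piFinSuccAbove (fun _ : Fin 4 => ℝ) 0).symm x
      = Fin.cons x.1 x.2 := fun x => by
    funext i
    refine Fin.cases ?_ (fun j => ?_) i <;> simp [MeasurableEquiv.piFinSuccAbove]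
  have hpre : (MeasurableEquiv.piFinSuccAbove (fun _ : Fin 4 => ℝ) 0).symm ⁻¹'
      (Set.Icc (Fin.cons c (fun _ => -T) : Fin 4 → ℝ) (Fin.cons t (fun _ => T))) =
      Set.Icc c t ×ˢ Set.Icc (fun _ : Fin 3 => -T) (fun _ => T) := by
    ext ⟨s, y⟩
    rw [Set.mem_preimage, hsymm]
    simp only [Set.mem_Icc, Set.mem_prod, Fin.cons_le_cons]
    tauto
  have hcs : Continuous fun x : ℝ × (Fin 3 → ℝ) => (Fin.cons x.1 x.2 : Fin 4 → ℝ) := by fun_prop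
  rw [← hmp.setIntegral_preimage_emb (MeasurableEquiv.measurableEmbedding _), hpre]
  simp only [hsymm]
  rw [Measure.volume_eq_prod, setIntegral_prod]
  · rw [intervalIntegral.integral_of_le hct, integral_Icc_eq_integral_Ioc]
  · refine ContinuousOn.integrableOn_compact (isCompact_Icc.prod isCompact_Icc) ?_
    exact (hg.comp hcs).continuousOn

theorem coneWeight_eq_zero_of_le {T : ℝ} {z : Fin 4 → ℝ} (h0 : 0 ≤ z 0) (hT : z 0 ≤ T) {μ : Fin 4}
    (hμ : μ ≠ 0) (hz : (z μ) ^ 2 = T ^ 2) : coneWeight T z = 0 := by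
  have h1 : (z μ) ^ 2 ≤ (z 1) ^ 2 + (z 2) ^ 2 + (z 3) ^ 2 := by
    fin_cases μ
    · exact absurd rfl hμ
    all_goals
      simp
      nlinarith [sq_nonneg (z 1), sq_nonneg (z 2), sq_nonneg (z 3)]
  have h2 : coneFun T z ≤ 0 := by
    unfold coneFun
    nlinarith
  simp [coneWeight, max_eq_left h2]

theorem integral_coneWeight_mul_current_le {u : (Fin 4 → ℝ) → ℝ} (hu : Smooth u) {c t T : ℝ}
    (hc : 0 ≤ c) (hct : c ≤ t) (htT : t ≤ T) (hvan : ∀ z : Fin 4 → ℝ, z 0 ≤ c → u z = 0) :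
    ∫ y in Set.Icc (fun _ : Fin 3 => -T) (fun _ => T),
        coneWeight T (Fin.cons t y) * current u 0 (Fin.cons t y) ≤
      ∫ s in c..t, ∫ y in Set.Icc (fun _ : Fin 3 => -T) (fun _ => T),
        coneWeight T (Fin.cons s y) * (pd 0 u (Fin.cons s y) * Box u (Fin.cons s y)) := by
  have hT : 0 ≤ T := by linarith
  set a : Fin 4 → ℝ := Fin.cons c (fun _ => -T) with ha
  set b : Fin 4 → ℝ := Fin.cons t (fun _ => T) with hb
  have hab : a ≤ b := by
    rw [ha, hb, Fin.cons_le_cons]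
    exact ⟨hct, fun _ => by simp; linarith⟩
  set f : (Fin 4 → ℝ) → Fin 4 → ℝ := fun z μ => coneWeight T z * current u μ z with hf
  have hdiff : ∀ μ, Differentiable ℝ (fun z => f z μ) := fun μ =>
    (differentiable_coneWeight T).mul (hu.current μ).differentiable
  set f' : (Fin 4 → ℝ) → (Fin 4 → ℝ) →L[ℝ] Fin 4 → ℝ :=
    fun z => ContinuousLinearMap.pi fun μ => fderiv ℝ (fun z => f z μ) z with hf'
  have hdiv : ∀ z, ∑ μ, f' z (Pi.single μ 1) μ =
      ∑ μ, pd μ (coneWeight T) z * current u μ z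
        + coneWeight T z * (pd 0 u z * Box u z) := by
    intro z
    rw [← sum_pd_current hu, Finset.mul_sum, ← Finset.sum_add_distrib]
    refine Finset.sum_congr rfl fun μ _ => ?_
    exact pd_mul (differentiable_coneWeight T z) ((hu.current μ).differentiable z) μ
  have hcw : ∀ μ, Continuous (pd μ (coneWeight T)) := by
    intro μ
    have : pd μ (coneWeight T) = fun z => -4 * max 0 (coneFun T z) *
        (if μ = 0 then T - z 0 else z μ) := funext (pd_coneWeight T μ)
    rw [this]
    refine (continuous_const.mul (continuous_const.max (continuous_coneFun T))).mul ?_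
    split_ifs <;> fun_prop
  have hcs : Continuous fun z => coneWeight T z * (pd 0 u z * Box u z) :=
    (continuous_coneWeight T).mul ((hu.pd 0).continuous.mul hu.box.continuous)
  have hcf : Continuous fun z => ∑ μ, pd μ (coneWeight T) z * current u μ z :=
    continuous_finsetSum _ fun μ _ => (hcw μ).mul (hu.current μ).continuous
  have hcdiv : Continuous fun z => ∑ μ, f' z (Pi.single μ 1) μ := by
    simp only [hdiv]
    exact hcf.add hcs
  have hK : IsCompact (Set.Icc a b) := isCompact_Icc
  have hstokes := integral_divergence_of_hasFDerivAt_off_countable a b hab f f' ∅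
    Set.countable_empty (continuous_pi fun μ => (hdiff μ).continuous).continuousOn
    (fun z _ => hasFDerivAt_pi.2 fun μ => (hdiff μ z).hasFDerivAt)
    (hcdiv.continuousOn.integrableOn_compact hK)
  have hside : ∀ i : Fin 3, ∀ s : ℝ, s ^ 2 = T ^ 2 →
      ∫ x in Set.Icc (a ∘ (Fin.succ i).succAbove) (b ∘ (Fin.succ i).succAbove),
        f ((Fin.succ i).insertNth s x) (Fin.succ i) = 0 := by
    intro i s hs
    refine setIntegral_eq_zero_of_forall_eq_zero fun x hx => ?_
    have e0 : ((Fin.succ i).insertNth s x : Fin 4 → ℝ) 0 = x 0 := by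
      have := Fin.insertNth_apply_succAbove (α := fun _ => ℝ) (Fin.succ i) s x 0
      rwa [Fin.succAbove_ne_zero_zero (Fin.succ_ne_zero i)] at this
    have l0 := hx.1 0
    have u0 := hx.2 0
    simp only [Function.comp, Fin.succAbove_ne_zero_zero (Fin.succ_ne_zero i), ha, hb,
      Fin.cons_zero] at l0 u0
    have : coneWeight T ((Fin.succ i).insertNth s x) = 0 :=
      coneWeight_eq_zero_of_le (μ := Fin.succ i) (by rw [e0]; linarith) (by rw [e0]; linarith)
        (Fin.succ_ne_zero i) (by rw [Fin.insertNth_apply_same]; exact hs)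
    simp only [hf, this, zero_mul]
  rw [Fin.sum_univ_succ] at hstokes
  have hsides : ∑ i : Fin 3, ((∫ x in Set.Icc (a ∘ (Fin.succ i).succAbove)
      (b ∘ (Fin.succ i).succAbove), f ((Fin.succ i).insertNth (b (Fin.succ i)) x) (Fin.succ i)) -
      ∫ x in Set.Icc (a ∘ (Fin.succ i).succAbove) (b ∘ (Fin.succ i).succAbove),
        f ((Fin.succ i).insertNth (a (Fin.succ i)) x) (Fin.succ i)) = 0 :=
    Finset.sum_eq_zero fun i _ => by
      rw [hside i _ (by simp [hb]), hside i _ (by simp [ha]), sub_zero]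
  have hbot : ∫ x in Set.Icc (a ∘ (0 : Fin 4).succAbove) (b ∘ (0 : Fin 4).succAbove),
      f ((0 : Fin 4).insertNth (a 0) x) 0 = 0 := by
    refine setIntegral_eq_zero_of_forall_eq_zero fun x _ => ?_
    have h0 : ∀ j, pd j u ((0 : Fin 4).insertNth (a 0) x) = 0 := fun j =>
      pd_eq_zero_of_le hu hvan j _ (by simp [ha])
    simp only [hf, current, h0]
    simp
  have htop : ∫ x in Set.Icc (a ∘ (0 : Fin 4).succAbove) (b ∘ (0 : Fin 4).succAbove),
      f ((0 : Fin 4).insertNth (b 0) x) 0 =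
      ∫ y in Set.Icc (fun _ : Fin 3 => -T) (fun _ => T),
        coneWeight T (Fin.cons t y) * current u 0 (Fin.cons t y) := by
    have ea : a ∘ (0 : Fin 4).succAbove = fun _ => -T := by funext j; simp [ha]
    have eb : b ∘ (0 : Fin 4).succAbove = fun _ => T := by funext j; simp [hb]
    rw [ea, eb]
    simp [hf, hb]
  rw [hsides, hbot, htop, sub_zero, add_zero] at hstokes
  rw [← hstokes, ← integral_Icc_cons hcs hct]
  refine setIntegral_mono_on (hcdiv.continuousOn.integrableOn_compact hK)
    (hcs.continuousOn.integrableOn_compact hK) measurableSet_Icc fun z hz => ?_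
  rw [hdiv]
  have hz0 : z 0 ≤ T := by
    have := hz.2 0
    simp only [hb, Fin.cons_zero] at this
    linarith
  linarith [sum_pd_coneWeight_mul_current_nonpos (u := u) hz0]

/-- Local energy inequality for solutions of the wave equation with vanishing Cauchy data. -/
theorem energy_estimate {u : (Fin 4 → ℝ) → ℝ} (hu : Smooth u) {c t : ℝ} (hc : 0 ≤ c) (hct : c ≤ t)
    (hvan : ∀ z : Fin 4 → ℝ, z 0 ≤ c → u z = 0) {h : ℝ → ℝ} (hh : ContinuousOn h (Set.Icc c t))
    (h0 : ∀ s, 0 ≤ h s)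
    (hF : ∀ s ∈ Set.Icc c t, ∀ T : ℝ, ∫ y in Set.Icc (fun _ : Fin 3 => -T) (fun _ => T),
      Box u (Fin.cons s y) ^ 2 ≤ h s ^ 2) (R : ℝ) (hR : 0 ≤ R) (μ : Fin 4) :
    ∫ y in Set.Icc (fun _ : Fin 3 => -R) (fun _ => R), pd μ u (Fin.cons t y) ^ 2 ≤
      16 * (∫ s in c..t, h s) ^ 2 := by
  set T : ℝ := 8 * (t + R + 1) with hTdef
  have ht0 : 0 ≤ t := hc.trans hct
  have hT : 0 < T := by positivity
  have htT : t ≤ T := by rw [hTdef]; linarith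
  set K := Set.Icc (fun _ : Fin 3 => -T) (fun _ => T) with hK
  have hKc : IsCompact K := isCompact_Icc
  have hcons : Continuous fun x : ℝ × (Fin 3 → ℝ) => (Fin.cons x.1 x.2 : Fin 4 → ℝ) := by fun_prop
  have hcons1 : ∀ s : ℝ, Continuous fun y : Fin 3 → ℝ => (Fin.cons s y : Fin 4 → ℝ) := fun s => by
    fun_prop
  have int : ∀ {g : (Fin 4 → ℝ) → ℝ}, Continuous g → ∀ s : ℝ,
      IntegrableOn (fun y : Fin 3 → ℝ => g (Fin.cons s y)) K :=
    fun hg s => (hg.comp (hcons1 s)).continuousOn.integrableOn_compact hKc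
  set I : ℝ → ℝ := fun s => ∫ y in K, coneWeight T (Fin.cons s y) * current u 0 (Fin.cons s y)
    with hI
  have cI : Continuous fun z => coneWeight T z * current u 0 z :=
    (continuous_coneWeight T).mul (hu.current 0).continuous
  have hIc : Continuous I :=
    continuous_parametric_integral_of_continuous (f := fun s y =>
      coneWeight T (Fin.cons s y) * current u 0 (Fin.cons s y)) (cI.comp hcons) hKc
  have hcur : ∀ z, (pd 0 u z) ^ 2 ≤ 2 * current u 0 z := fun z => by
    simp only [current, if_true]
    nlinarith [sq_nonneg (pd 1 u z), sq_nonneg (pd 2 u z), sq_nonneg (pd 3 u z)]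
  have hcurμ : ∀ z, (pd μ u z) ^ 2 ≤ 2 * current u 0 z := fun z => by
    simp only [current, if_true]
    fin_cases μ <;> simp <;>
    nlinarith [sq_nonneg (pd 0 u z), sq_nonneg (pd 1 u z), sq_nonneg (pd 2 u z),
      sq_nonneg (pd 3 u z)]
  have hcur0 : ∀ z, 0 ≤ current u 0 z := fun z => by
    have := hcur z
    nlinarith [sq_nonneg (pd 0 u z)]
  have hInn : ∀ s, 0 ≤ I s := fun s =>
    integral_nonneg fun y => mul_nonneg (coneWeight_nonneg _ _) (hcur0 _)
  have hsrc : ∀ s ∈ Set.Icc c t, ∫ y in K, coneWeight T (Fin.cons s y) *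
      (pd 0 u (Fin.cons s y) * Box u (Fin.cons s y)) ≤ Real.sqrt (2 * I s) * (T ^ 2 * h s) := by
    intro s hs
    have cm : Continuous fun z => max 0 (coneFun T z) :=
      continuous_const.max (continuous_coneFun T)
    have c1 : Continuous fun z => max 0 (coneFun T z) * pd 0 u z := cm.mul (hu.pd 0).continuous
    have c2 : Continuous fun z => max 0 (coneFun T z) * Box u z := cm.mul hu.box.continuous
    have cs := sq_integral_mul_le (int (c1.pow 2) s) (int (c2.pow 2) s) (int (c1.mul c2) s)
    have b1 : ∫ y in K, (max 0 (coneFun T (Fin.cons s y)) * pd 0 u (Fin.cons s y)) ^ 2 ≤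
        2 * I s := by
      rw [hI, ← integral_const_mul]
      refine integral_mono (int (c1.pow 2) s) ((int cI s).const_mul 2) fun y => ?_
      have := mul_le_mul_of_nonneg_left (hcur (Fin.cons s y)) (coneWeight_nonneg T (Fin.cons s y))
      simp only [coneWeight] at this ⊢
      rw [mul_pow]
      linarith
    have hm : ∀ y : Fin 3 → ℝ, max 0 (coneFun T (Fin.cons s y)) ^ 2 ≤ (T ^ 2) ^ 2 := by
      intro y
      refine pow_le_pow_left₀ (le_max_left _ _) (max_le (by positivity) ?_) 2
      simp only [coneFun, Fin.cons_zero]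
      have : (T - s) ^ 2 ≤ T ^ 2 := by
        have := hs.1
        have := hs.2
        nlinarith
      have h3 := add_nonneg (add_nonneg (sq_nonneg ((Fin.cons s y : Fin 4 → ℝ) 1))
        (sq_nonneg ((Fin.cons s y : Fin 4 → ℝ) 2))) (sq_nonneg ((Fin.cons s y : Fin 4 → ℝ) 3))
      linarith
    have b2 : ∫ y in K, (max 0 (coneFun T (Fin.cons s y)) * Box u (Fin.cons s y)) ^ 2 ≤
        (T ^ 2 * h s) ^ 2 := by
      rw [mul_pow]
      refine le_trans ?_ (mul_le_mul_of_nonneg_left (hF s hs T) (sq_nonneg _))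
      rw [← integral_const_mul]
      refine integral_mono (int (c2.pow 2) s) ((int (hu.box.continuous.pow 2) s).const_mul _)
        fun y => ?_
      simp only [mul_pow]
      exact mul_le_mul_of_nonneg_right (hm y) (sq_nonneg _)
    have e : ∫ y in K, coneWeight T (Fin.cons s y) *
        (pd 0 u (Fin.cons s y) * Box u (Fin.cons s y)) =
        ∫ y in K, (max 0 (coneFun T (Fin.cons s y)) * pd 0 u (Fin.cons s y)) *
          (max 0 (coneFun T (Fin.cons s y)) * Box u (Fin.cons s y)) := by
      congr 1; funext y; simp only [coneWeight]; ring
    rw [e]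
    refine abs_le_of_sq_le_sq' ?_ (mul_nonneg (Real.sqrt_nonneg _)
      (mul_nonneg (sq_nonneg _) (h0 s))) |>.2
    refine cs.trans ?_
    rw [mul_pow, Real.sq_sqrt (mul_nonneg zero_le_two (hInn s))]
    exact mul_le_mul b1 b2 (integral_nonneg fun _ => sq_nonneg _)
      (mul_nonneg zero_le_two (hInn s))
  obtain ⟨s₀, hs₀, hmax⟩ := isCompact_Icc.exists_isMaxOn (Set.nonempty_Icc.2 hct)
    hIc.continuousOn
  set H := ∫ s in c..t, h s with hH
  have hhi : IntervalIntegrable h volume c t := by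
    refine ContinuousOn.intervalIntegrable ?_
    rwa [Set.uIcc_of_le hct]
  have hH0 : 0 ≤ H := intervalIntegral.integral_nonneg hct fun s _ => h0 s
  have hI0 : I s₀ ≤ Real.sqrt (2 * I s₀) * (T ^ 2 * H) := by
    have hsub : Set.Icc c s₀ ⊆ Set.Icc c t := Set.Icc_subset_Icc le_rfl hs₀.2
    have hhi0 : IntervalIntegrable h volume c s₀ := by
      refine ContinuousOn.intervalIntegrable ?_
      rw [Set.uIcc_of_le hs₀.1]
      exact hh.mono hsub
    have hhi1 : IntervalIntegrable h volume s₀ t := by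
      refine ContinuousOn.intervalIntegrable ?_
      rw [Set.uIcc_of_le hs₀.2]
      exact hh.mono (Set.Icc_subset_Icc hs₀.1 le_rfl)
    have csrc : Continuous fun s => ∫ y in K, coneWeight T (Fin.cons s y) *
        (pd 0 u (Fin.cons s y) * Box u (Fin.cons s y)) :=
      continuous_parametric_integral_of_continuous (f := fun s y =>
        coneWeight T (Fin.cons s y) * (pd 0 u (Fin.cons s y) * Box u (Fin.cons s y)))
        (((continuous_coneWeight T).mul
          ((hu.pd 0).continuous.mul hu.box.continuous)).comp hcons) hKc
    calc I s₀ ≤ ∫ s in c..s₀, ∫ y in K, coneWeight T (Fin.cons s y) *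
          (pd 0 u (Fin.cons s y) * Box u (Fin.cons s y)) :=
          integral_coneWeight_mul_current_le hu hc hs₀.1 (hs₀.2.trans htT) hvan
      _ ≤ ∫ s in c..s₀, (Real.sqrt (2 * I s₀) * T ^ 2) * h s := by
          refine intervalIntegral.integral_mono_on hs₀.1 (csrc.intervalIntegrable _ _)
            (hhi0.const_mul _) fun s hs => ?_
          refine (hsrc s (hsub hs)).trans ?_
          rw [← mul_assoc]
          refine mul_le_mul_of_nonneg_right (mul_le_mul_of_nonneg_right
            (Real.sqrt_le_sqrt ?_) (sq_nonneg _)) (h0 s)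
          have : I s ≤ I s₀ := hmax (hsub hs)
          linarith
      _ = (Real.sqrt (2 * I s₀) * T ^ 2) * ∫ s in c..s₀, h s :=
          intervalIntegral.integral_const_mul _ _
      _ ≤ (Real.sqrt (2 * I s₀) * T ^ 2) * H := by
          refine mul_le_mul_of_nonneg_left ?_ (mul_nonneg (Real.sqrt_nonneg _) (sq_nonneg _))
          rw [hH, ← intervalIntegral.integral_add_adjacent_intervals hhi0 hhi1]
          have : 0 ≤ ∫ s in s₀..t, h s := intervalIntegral.integral_nonneg hs₀.2 fun s _ => h0 s
          linarith
      _ = _ := by ring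
  have hIt : I t ≤ 2 * (T ^ 2 * H) ^ 2 := by
    have h1 : I t ≤ I s₀ := hmax (Set.right_mem_Icc.2 hct)
    refine h1.trans ?_
    have hsq := Real.sq_sqrt (mul_nonneg zero_le_two (hInn s₀))
    have hX : 0 ≤ T ^ 2 * H := mul_nonneg (sq_nonneg _) hH0
    nlinarith [sq_nonneg (Real.sqrt (2 * I s₀) - 2 * (T ^ 2 * H)), Real.sqrt_nonneg (2 * I s₀)]
  have hsub : Set.Icc (fun _ : Fin 3 => -R) (fun _ => R) ⊆ K := by
    refine Set.Icc_subset_Icc (fun _ => ?_) (fun _ => ?_) <;> simp <;> rw [hTdef] <;> linarith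
  have hw : ∀ y ∈ Set.Icc (fun _ : Fin 3 => -R) (fun _ => R),
      T ^ 4 / 4 ≤ coneWeight T (Fin.cons t y) := by
    intro y hy
    have hyi : ∀ i, (y i) ^ 2 ≤ R ^ 2 := fun i => by
      have h1 := hy.1 i
      have h2 := hy.2 i
      simp only at h1 h2
      nlinarith
    have hq : T ^ 2 / 2 ≤ coneFun T (Fin.cons t y) := by
      have e1 : (Fin.cons t y : Fin 4 → ℝ) 1 = y 0 := rfl
      have e2 : (Fin.cons t y : Fin 4 → ℝ) 2 = y 1 := rfl
      have e3 : (Fin.cons t y : Fin 4 → ℝ) 3 = y 2 := rfl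
      simp only [coneFun, Fin.cons_zero, e1, e2, e3]
      have := hyi 0
      have := hyi 1
      have := hyi 2
      rw [hTdef]
      nlinarith [mul_nonneg ht0 hR]
    have := hq.trans (le_max_right 0 _)
    calc T ^ 4 / 4 = (T ^ 2 / 2) ^ 2 := by ring
      _ ≤ _ := pow_le_pow_left₀ (by positivity) this 2
  have hfin : T ^ 4 / 8 * ∫ y in Set.Icc (fun _ : Fin 3 => -R) (fun _ => R),
      pd μ u (Fin.cons t y) ^ 2 ≤ I t := by
    rw [← integral_const_mul]
    calc ∫ y in Set.Icc (fun _ : Fin 3 => -R) (fun _ => R),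
          T ^ 4 / 8 * pd μ u (Fin.cons t y) ^ 2
        ≤ ∫ y in Set.Icc (fun _ : Fin 3 => -R) (fun _ => R),
          coneWeight T (Fin.cons t y) * current u 0 (Fin.cons t y) := by
          refine setIntegral_mono_on
            (((int ((hu.pd μ).continuous.pow 2) t).mono_set hsub).const_mul _)
            ((int cI t).mono_set hsub) measurableSet_Icc fun y hy => ?_
          have h1 := hw y hy
          have h2 := hcurμ (Fin.cons t y)
          have h3 := hcur0 (Fin.cons t y)
          have hT4 : 0 ≤ T ^ 4 / 8 := by positivity
          calc T ^ 4 / 8 * pd μ u (Fin.cons t y) ^ 2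
              ≤ T ^ 4 / 8 * (2 * current u 0 (Fin.cons t y)) :=
                mul_le_mul_of_nonneg_left h2 hT4
            _ = T ^ 4 / 4 * current u 0 (Fin.cons t y) := by ring
            _ ≤ _ := mul_le_mul_of_nonneg_right h1 h3
      _ ≤ I t := setIntegral_mono_set (int cI t) (Filter.Eventually.of_forall fun y =>
            mul_nonneg (coneWeight_nonneg _ _) (hcur0 _)) hsub.eventuallyLE
  have hT4 : 0 < T ^ 4 / 8 := by positivity
  refine le_of_mul_le_mul_left ?_ hT4
  refine hfin.trans (hIt.trans_eq ?_)
  ring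

section Dyadic

variable {g : ℝ → ℝ} {B t : ℝ}

theorem sSup_dyadic_nonneg (h0 : ∀ s, 0 ≤ g s) (k : ℤ) :
    0 ≤ sSup ((fun τ => (2:ℝ)^k * g τ) ''
      (Set.Icc ((2:ℝ)^(k-1)) ((2:ℝ)^(k+1)) ∩ Set.Icc (2*B) t)) := by
  refine Real.sSup_nonneg ?_
  rintro _ ⟨τ, -, rfl⟩
  exact mul_nonneg (by positivity) (h0 τ)

theorem dyadic_nonneg (h0 : ∀ s, 0 ≤ g s) : 0 ≤ dyadic g B t :=
  tsum_nonneg fun k => sSup_dyadic_nonneg h0 k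

theorem summable_dyadic (hB : 0 < B) (hBt : 2 * B ≤ t) :
    Summable fun k : ℤ => sSup ((fun τ => (2:ℝ)^k * g τ) ''
      (Set.Icc ((2:ℝ)^(k-1)) ((2:ℝ)^(k+1)) ∩ Set.Icc (2*B) t)) := by
  refine summable_of_ne_finset_zero
    (s := Finset.Icc (Int.log 2 (2*B) - 1) (Int.log 2 t + 1)) fun k hk => ?_
  have : Set.Icc ((2:ℝ)^(k-1)) ((2:ℝ)^(k+1)) ∩ Set.Icc (2*B) t = ∅ := by
    refine Set.eq_empty_iff_forall_notMem.2 fun τ hτ => hk ?_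
    obtain ⟨⟨h1, h2⟩, h3, h4⟩ := hτ
    have e1 : k - 1 ≤ Int.log 2 t :=
      (Int.zpow_le_iff_le_log (b := 2) one_lt_two (by linarith)).1 (by push_cast; linarith)
    have e2 : Int.log 2 (2*B) ≤ k + 1 := by
      have := Int.log_mono_right (b := 2) (r₁ := 2*B) (r₂ := ((2:ℕ):ℝ)^(k+1)) (by linarith)
        (by push_cast; linarith)
      rwa [Int.log_zpow one_lt_two] at this
    exact Finset.mem_Icc.2 ⟨by omega, by omega⟩
  rw [this]; simp

theorem mul_le_sSup_dyadic (hg : ContinuousOn g (Set.Icc (2*B) t)) {k : ℤ} {τ : ℝ}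
    (h1 : τ ∈ Set.Icc ((2:ℝ)^(k-1)) ((2:ℝ)^(k+1))) (h2 : τ ∈ Set.Icc (2*B) t) :
    (2:ℝ)^k * g τ ≤ sSup ((fun τ => (2:ℝ)^k * g τ) ''
      (Set.Icc ((2:ℝ)^(k-1)) ((2:ℝ)^(k+1)) ∩ Set.Icc (2*B) t)) := by
  refine le_csSup ?_ ⟨τ, ⟨h1, h2⟩, rfl⟩
  have hc : IsCompact (Set.Icc (2*B) t) := isCompact_Icc
  exact (hc.bddAbove_image (f := fun τ => (2:ℝ)^k * g τ) (continuousOn_const.mul hg)).mono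
    (Set.image_mono Set.inter_subset_right)

theorem mem_Icc_zpow_log {τ : ℝ} (hτ : 0 < τ) :
    τ ∈ Set.Ico ((2:ℝ)^(Int.log 2 τ)) ((2:ℝ)^(Int.log 2 τ+1)) :=
  ⟨by simpa using Int.zpow_log_le_self (b := 2) one_lt_two hτ,
    by simpa using Int.lt_zpow_succ_log_self (b := 2) one_lt_two τ⟩

theorem mul_le_two_mul_dyadic (hB : 0 < B) (hBt : 2 * B ≤ t)
    (hg : ContinuousOn g (Set.Icc (2*B) t)) (h0 : ∀ s, 0 ≤ g s) :
    t * g t ≤ 2 * dyadic g B t := by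
  have ht : 0 < t := by linarith
  obtain ⟨h1, h2⟩ := mem_Icc_zpow_log ht
  set k := Int.log 2 t
  have h3 : (2:ℝ)^(k-1) ≤ 2^k := zpow_le_zpow_right₀ (by norm_num) (by omega)
  have h4 := mul_le_sSup_dyadic hg (k := k) (τ := t) ⟨h3.trans h1, h2.le⟩ ⟨hBt, le_rfl⟩
  have h5 := (summable_dyadic (g := g) hB hBt).le_tsum k fun j _ => sSup_dyadic_nonneg h0 j
  have h6 : (2:ℝ)^(k+1) = 2 * 2^k := by rw [zpow_add_one₀ (by norm_num)]; ring
  have h7 : t * g t ≤ 2 * 2^k * g t := mul_le_mul_of_nonneg_right (by linarith) (h0 t)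
  change _ ≤ dyadic g B t at h5
  linarith

theorem integral_le_dyadic (hB : 0 < B) (hBt : 2 * B ≤ t)
    (hg : ContinuousOn g (Set.Icc (2*B) t)) (h0 : ∀ s, 0 ≤ g s) :
    ∫ s in (2*B)..t, g s ≤ dyadic g B t := by
  set S : ℤ → ℝ := fun k => sSup ((fun τ => (2:ℝ)^k * g τ) ''
    (Set.Icc ((2:ℝ)^(k-1)) ((2:ℝ)^(k+1)) ∩ Set.Icc (2*B) t)) with hS
  have hS0 : ∀ k, 0 ≤ S k := sSup_dyadic_nonneg h0
  set K := Finset.Icc (Int.log 2 (2*B)) (Int.log 2 t)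
  set φ : ℤ → ℝ → ℝ := fun k => (Set.Ico ((2:ℝ)^k) ((2:ℝ)^(k+1))).indicator
    fun _ => (2:ℝ)^(-k) * S k with hφ
  have hφ0 : ∀ k s, 0 ≤ φ k s := fun k s =>
    Set.indicator_nonneg (fun _ _ => mul_nonneg (by positivity) (hS0 k)) s
  have hfi : ∀ k, Integrable (φ k) := fun k => by
    refine (integrable_indicator_iff measurableSet_Ico).2 (integrableOn_const (by simp))
  have hval : ∀ k, ∫ s, φ k s = S k := fun k => by
    have hpos : (0:ℝ) < 2^k := by positivity
    have h2 : (2:ℝ)^(k+1) = 2 * 2^k := by rw [zpow_add_one₀ (by norm_num)]; ring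
    rw [hφ, integral_indicator measurableSet_Ico, setIntegral_const, Real.volume_real_Ico_of_le
      (by linarith), h2, zpow_neg, smul_eq_mul]
    field_simp
    ring
  have hle : ∀ s ∈ Set.Icc (2*B) t, g s ≤ ∑ k ∈ K, φ k s := by
    intro s hs
    have hs0 : 0 < s := by linarith [hs.1]
    have hmem := mem_Icc_zpow_log hs0
    have hk : Int.log 2 s ∈ K := Finset.mem_Icc.2
      ⟨Int.log_mono_right (by linarith) hs.1, Int.log_mono_right hs0 hs.2⟩
    refine le_trans ?_ (Finset.single_le_sum (fun k _ => hφ0 k s) hk)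
    rw [hφ]
    simp only
    rw [Set.indicator_of_mem hmem]
    set k := Int.log 2 s
    have h3 : (2:ℝ)^(k-1) ≤ 2^k := zpow_le_zpow_right₀ (by norm_num) (by omega)
    have h4 := mul_le_sSup_dyadic hg (k := k) (τ := s) ⟨h3.trans hmem.1, hmem.2.le⟩ hs
    have hpos : (0:ℝ) < 2^k := by positivity
    rw [zpow_neg, inv_mul_eq_div, le_div_iff₀ hpos, mul_comm]
    exact h4
  have hsum : Integrable fun s => ∑ k ∈ K, φ k s := integrable_finsetSum _ fun k _ => hfi k
  calc ∫ s in (2*B)..t, g s ≤ ∫ s in (2*B)..t, ∑ k ∈ K, φ k s :=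
        intervalIntegral.integral_mono_on hBt (hg.intervalIntegrable_of_Icc hBt)
          hsum.intervalIntegrable hle
    _ ≤ ∫ s, ∑ k ∈ K, φ k s := by
        rw [intervalIntegral.integral_of_le hBt]
        exact setIntegral_le_integral hsum
          (Filter.Eventually.of_forall fun s => Finset.sum_nonneg fun k _ => hφ0 k s)
    _ = ∑ k ∈ K, S k := by
        rw [integral_finsetSum _ fun k _ => hfi k]
        exact Finset.sum_congr rfl fun k _ => hval k
    _ ≤ dyadic g B t := (summable_dyadic hB hBt).sum_le_tsum K fun k _ => hS0 k

end Dyadic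

theorem rad_cons (t : ℝ) (y : Fin 3 → ℝ) :
    rad (Fin.cons t y) = Real.sqrt (y 0 ^ 2 + y 1 ^ 2 + y 2 ^ 2) := rfl

theorem mem_Icc_of_rad_le {t T : ℝ} {y : Fin 3 → ℝ} (h : rad (Fin.cons t y) ≤ T) :
    y ∈ Set.Icc (fun _ : Fin 3 => -T) (fun _ => T) := by
  have hT : 0 ≤ T := (Real.sqrt_nonneg _).trans h
  rw [rad_cons, Real.sqrt_le_left hT] at h
  have : ∀ i, |y i| ≤ T := by
    intro i
    refine abs_le_of_sq_le_sq ?_ hT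
    fin_cases i <;> simp <;> nlinarith [sq_nonneg (y 0), sq_nonneg (y 1), sq_nonneg (y 2)]
  exact ⟨fun i => (abs_le.1 (this i)).1, fun i => (abs_le.1 (this i)).2⟩

theorem continuous_cons_uncurry :
    Continuous fun p : ℝ × (Fin 3 → ℝ) => (Fin.cons p.1 p.2 : Fin 4 → ℝ) := by
  refine continuous_pi fun i => ?_
  refine Fin.cases ?_ (fun j => ?_) i
  · exact continuous_fst
  · exact (continuous_apply j).comp continuous_snd

section L2

variable {f : (Fin 4 → ℝ) → ℝ} {B t : ℝ}

theorem integral_sq_eq_setIntegral (hB : 0 ≤ B)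
    (hsupp : ∀ z, rad z > z 0 - B → f z = 0) {s T : ℝ} (hs : s ≤ T) :
    ∫ y : Fin 3 → ℝ, f (Fin.cons s y) ^ 2 =
      ∫ y in Set.Icc (fun _ : Fin 3 => -T) (fun _ => T), f (Fin.cons s y) ^ 2 := by
  symm
  refine setIntegral_eq_integral_of_forall_compl_eq_zero fun y hy => ?_
  rw [hsupp, zero_pow two_ne_zero]
  by_contra h
  refine hy (mem_Icc_of_rad_le (t := s) ?_)
  have : (Fin.cons s y : Fin 4 → ℝ) 0 = s := rfl
  rw [this] at h
  linarith

theorem setIntegral_sq_le_L2x_sq (hB : 0 ≤ B) (hf : Continuous f)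
    (hsupp : ∀ z, rad z > z 0 - B → f z = 0) (s T : ℝ) :
    ∫ y in Set.Icc (fun _ : Fin 3 => -T) (fun _ => T), f (Fin.cons s y) ^ 2 ≤ L2x f s ^ 2 := by
  have hc : Continuous fun y : Fin 3 → ℝ => f (Fin.cons s y) ^ 2 :=
    (hf.comp (continuous_cons_uncurry.comp (Continuous.prodMk_right s))).pow 2
  rw [L2x, Real.sq_sqrt (integral_nonneg fun _ => sq_nonneg _),
    integral_sq_eq_setIntegral hB hsupp (le_max_left s T)]
  refine setIntegral_mono_set (hc.continuousOn.integrableOn_compact isCompact_Icc)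
    (Filter.Eventually.of_forall fun _ => sq_nonneg _) (Filter.Eventually.of_forall ?_)
  refine Set.Icc_subset_Icc (fun i => ?_) (fun i => ?_)
  · simp only; linarith [le_max_right s T]
  · exact le_max_right s T

theorem continuousOn_L2x (hB : 0 ≤ B) (hf : Continuous f)
    (hsupp : ∀ z, rad z > z 0 - B → f z = 0) (a T : ℝ) : ContinuousOn (L2x f) (Set.Icc a T) := by
  have hc : Continuous (Function.uncurry fun (s : ℝ) (y : Fin 3 → ℝ) => f (Fin.cons s y) ^ 2) :=
    (hf.comp continuous_cons_uncurry).pow 2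
  have h : Continuous fun s : ℝ => Real.sqrt
      (∫ y in Set.Icc (fun _ : Fin 3 => -T) (fun _ => T), f (Fin.cons s y) ^ 2) :=
    (continuous_parametric_integral_of_continuous hc isCompact_Icc).sqrt
  refine h.continuousOn.congr fun s hs => ?_
  simp only [L2x]
  rw [integral_sq_eq_setIntegral hB hsupp hs.2]

end L2

/-- The index set of the words of length at most two in the fields `GammaField`. -/
abbrev Word := Σ n : Fin 3, Fin n → Fin 10

/-- The right-hand side of the decay estimate. -/
def dyadicSum (F : (Fin 4 → ℝ) → ℝ) (B t : ℝ) : ℝ :=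
  ∑ n ∈ Finset.range 3, ∑ σ : Fin n → Fin 10, dyadic (L2x (opIter GammaField (List.ofFn σ) F)) B t

theorem L2x_nonneg (f : (Fin 4 → ℝ) → ℝ) (s : ℝ) : 0 ≤ L2x f s := Real.sqrt_nonneg _

theorem dyadic_L2x_nonneg (f : (Fin 4 → ℝ) → ℝ) (B t : ℝ) : 0 ≤ dyadic (L2x f) B t :=
  dyadic_nonneg (L2x_nonneg f)

theorem dyadicSum_nonneg (F : (Fin 4 → ℝ) → ℝ) (B t : ℝ) : 0 ≤ dyadicSum F B t :=
  Finset.sum_nonneg fun _ _ => Finset.sum_nonneg fun _ _ => dyadic_L2x_nonneg _ B t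

theorem dyadic_le_dyadicSum (F : (Fin 4 → ℝ) → ℝ) (B t : ℝ) {L : List (Fin 10)}
    (hL : L.length ≤ 2) :
    dyadic (L2x (opIter GammaField L F)) B t ≤ dyadicSum F B t := by
  have h1 : dyadic (L2x (opIter GammaField L F)) B t ≤
      ∑ σ : Fin L.length → Fin 10, dyadic (L2x (opIter GammaField (List.ofFn σ) F)) B t := by
    have := Finset.single_le_sum (f := fun σ : Fin L.length → Fin 10 =>
      dyadic (L2x (opIter GammaField (List.ofFn σ) F)) B t)
      (fun σ _ => dyadic_L2x_nonneg _ B t) (Finset.mem_univ L.get)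
    simpa only [List.ofFn_get] using this
  refine h1.trans ?_
  exact Finset.single_le_sum (f := fun n => ∑ σ : Fin n → Fin 10,
    dyadic (L2x (opIter GammaField (List.ofFn σ) F)) B t)
    (fun n _ => Finset.sum_nonneg fun _ _ => dyadic_L2x_nonneg _ B t)
    (Finset.mem_range.2 (by omega))

theorem isOpen_rad_gt (B : ℝ) : IsOpen {z : Fin 4 → ℝ | rad z > z 0 - B} := by
  refine isOpen_lt (by fun_prop) ?_
  unfold rad
  fun_prop

/-- The sum of the first derivatives of all `Γ^α w` with `|α| ≤ 2`. -/
def gradSum (w : (Fin 4 → ℝ) → ℝ) (z : Fin 4 → ℝ) : ℝ :=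
  ∑ p : Word × Fin 4, |pd p.2 (opIter GammaField (List.ofFn p.1.2) w) z|

/-- The sum of all `Γ^α F` with `|α| ≤ 2`. -/
def sourceSum (F : (Fin 4 → ℝ) → ℝ) (z : Fin 4 → ℝ) : ℝ :=
  ∑ p : Word, |opIter GammaField (List.ofFn p.2) F z|

theorem gradSum_nonneg (w : (Fin 4 → ℝ) → ℝ) (z : Fin 4 → ℝ) : 0 ≤ gradSum w z :=
  Finset.sum_nonneg fun _ _ => abs_nonneg _

theorem abs_pd_opIter_le_gradSum (w : (Fin 4 → ℝ) → ℝ) {L : List (Fin 10)} (hL : L.length ≤ 2)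
    (μ : Fin 4) (z : Fin 4 → ℝ) : |pd μ (opIter GammaField L w) z| ≤ gradSum w z := by
  have := Finset.single_le_sum (f := fun p : Word × Fin 4 =>
    |pd p.2 (opIter GammaField (List.ofFn p.1.2) w) z|) (fun _ _ => abs_nonneg _)
    (Finset.mem_univ (⟨⟨L.length, by omega⟩, L.get⟩, μ))
  simpa only [List.ofFn_get, gradSum] using this

theorem abs_opIter_le_sourceSum (F : (Fin 4 → ℝ) → ℝ) {L : List (Fin 10)} (hL : L.length ≤ 2)
    (z : Fin 4 → ℝ) : |opIter GammaField L F z| ≤ sourceSum F z := by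
  have := Finset.single_le_sum (f := fun p : Word =>
    |opIter GammaField (List.ofFn p.2) F z|) (fun _ _ => abs_nonneg _)
    (Finset.mem_univ ⟨⟨L.length, by omega⟩, L.get⟩)
  simpa only [List.ofFn_get, sourceSum] using this

theorem Smooth.continuous_slice {u : (Fin 4 → ℝ) → ℝ} (hu : Smooth u) (t : ℝ) :
    Continuous fun y : Fin 3 → ℝ => u (Fin.cons t y) :=
  hu.continuous.comp (continuous_cons_uncurry.comp (Continuous.prodMk_right t))

theorem continuous_gradSum_slice {w : (Fin 4 → ℝ) → ℝ} (hw : Smooth w) (t : ℝ) :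
    Continuous fun y : Fin 3 → ℝ => gradSum w (Fin.cons t y) :=
  continuous_finsetSum _ fun _ _ => (((hw.opIter _).pd _).continuous_slice t).abs

theorem continuous_sourceSum_slice {F : (Fin 4 → ℝ) → ℝ} (hF : Smooth F) (t : ℝ) :
    Continuous fun y : Fin 3 → ℝ => sourceSum F (Fin.cons t y) :=
  continuous_finsetSum _ fun _ _ => ((hF.opIter _).continuous_slice t).abs

theorem setIntegral_sq_sum_abs_le {ι : Type*} [Fintype ι] {f : ι → (Fin 3 → ℝ) → ℝ}
    (hf : ∀ i, Continuous (f i)) {K : Set (Fin 3 → ℝ)} (hK : IsCompact K) {M : ℝ}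
    (h : ∀ i, ∫ y in K, f i y ^ 2 ≤ M ^ 2) :
    ∫ y in K, (∑ i, |f i y|) ^ 2 ≤ (Fintype.card ι * M) ^ 2 := by
  have hfi : ∀ i, IntegrableOn (fun y => f i y ^ 2) K := fun i =>
    ((hf i).pow 2).continuousOn.integrableOn_compact hK
  calc ∫ y in K, (∑ i, |f i y|) ^ 2 ≤ ∫ y in K, Fintype.card ι * ∑ i, f i y ^ 2 := by
        refine integral_mono ?_ ((integrable_finsetSum _ fun i _ => hfi i).const_mul _)
          fun y => ?_
        · exact ((continuous_finsetSum _ fun i _ => (hf i).abs).pow 2).continuousOn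
            |>.integrableOn_compact hK
        · simpa using sq_sum_le_card_mul_sum_sq (s := Finset.univ) (f := fun i => |f i y|)
    _ = Fintype.card ι * ∑ i, ∫ y in K, f i y ^ 2 := by
        rw [integral_const_mul, integral_finsetSum _ fun i _ => hfi i]
    _ ≤ Fintype.card ι * ∑ _i : ι, M ^ 2 := by
        gcongr with i
        exact h i
    _ = _ := by simp; ring

section Wave

variable {w : (Fin 4 → ℝ) → ℝ} {B t : ℝ}

theorem integral_gradSum_sq_le (hw : Smooth w) (hB : 0 < B) (hBt : 2 * B ≤ t)
    (hvan : ∀ z : Fin 4 → ℝ, z 0 ≤ 2*B → w z = 0)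
    (hsupp : ∀ z : Fin 4 → ℝ, rad z > z 0 - B → Box w z = 0) {R : ℝ} (hR : 0 ≤ R) :
    ∫ y in Set.Icc (fun _ : Fin 3 => -R) (fun _ => R), gradSum w (Fin.cons t y) ^ 2 ≤
      (Fintype.card (Word × Fin 4) * (4 * dyadicSum (Box w) B t)) ^ 2 := by
  refine setIntegral_sq_sum_abs_le (fun p => ((hw.opIter _).pd _).continuous_slice t)
    isCompact_Icc fun p => ?_
  set L := List.ofFn p.1.2 with hL
  have hLlen : L.length ≤ 2 := by rw [hL, List.length_ofFn]; omega
  have hsm : Smooth (opIter GammaField L (Box w)) := hw.box.opIter L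
  have hs := opIter_eq_zero_of_isOpen (isOpen_rad_gt B) hsupp L
  have hc := continuousOn_L2x hB.le hsm.continuous hs (2 * B) t
  have h0 := L2x_nonneg (opIter GammaField L (Box w))
  refine (energy_estimate (hw.opIter L) (c := 2 * B) (by linarith) hBt
    (opIter_eq_zero_of_le hw hvan L) hc h0 (fun s _ T => ?_) R hR p.2).trans ?_
  · rw [box_opIter hw L]
    exact setIntegral_sq_le_L2x_sq hB.le hsm.continuous hs s T
  · have h1 := (integral_le_dyadic hB hBt hc h0).trans (dyadic_le_dyadicSum (Box w) B t hLlen)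
    have h2 : 0 ≤ ∫ s in (2*B)..t, L2x (opIter GammaField L (Box w)) s :=
      intervalIntegral.integral_nonneg hBt fun s _ => h0 s
    nlinarith [dyadicSum_nonneg (Box w) B t]

theorem integral_sourceSum_sq_le (hw : Smooth w) (hB : 0 < B) (hBt : 2 * B ≤ t)
    (hsupp : ∀ z : Fin 4 → ℝ, rad z > z 0 - B → Box w z = 0) (R : ℝ) :
    ∫ y in Set.Icc (fun _ : Fin 3 => -R) (fun _ => R), sourceSum (Box w) (Fin.cons t y) ^ 2 ≤
      (Fintype.card Word * (2 * dyadicSum (Box w) B t / t)) ^ 2 := by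
  refine setIntegral_sq_sum_abs_le (fun p => (hw.box.opIter _).continuous_slice t)
    isCompact_Icc fun p => ?_
  set L := List.ofFn p.2 with hL
  have hLlen : L.length ≤ 2 := by rw [hL, List.length_ofFn]; omega
  have hsm : Smooth (opIter GammaField L (Box w)) := hw.box.opIter L
  have hs := opIter_eq_zero_of_isOpen (isOpen_rad_gt B) hsupp L
  have hc := continuousOn_L2x hB.le hsm.continuous hs (2 * B) t
  have h0 := L2x_nonneg (opIter GammaField L (Box w))
  refine (setIntegral_sq_le_L2x_sq hB.le hsm.continuous hs t R).trans
    (pow_le_pow_left₀ (h0 t) ?_ 2)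
  rw [le_div_iff₀ (by linarith)]
  linarith [mul_le_two_mul_dyadic hB hBt hc h0, dyadic_le_dyadicSum (Box w) B t hLlen]

end Wave

theorem abs_hessian_bounds {t r a f M P S b x c Q : ℝ} (ht : 0 < t) (hr0 : 0 ≤ r)
    (hr : r ≤ 3 / 4 * t) (hM : 0 ≤ M) (ha : (t ^ 2 - r ^ 2) * a = t ^ 2 * f + t * S)
    (hS : |S| ≤ 12 * M) (hx : |x| ≤ r) (hP : P = x * a + t * b) (hPM : |P| ≤ 2 * M)
    {y : ℝ} (hy : |y| ≤ r) (hQ : Q = y * b + t * c) (hQM : |Q| ≤ 2 * M) :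
    |a| ≤ 3 * |f| + 28 * M / t ∧ |b| ≤ 3 * |f| + 30 * M / t ∧ |c| ≤ 3 * |f| + 32 * M / t := by
  have hr2 : r ^ 2 ≤ 9 / 16 * t ^ 2 := by nlinarith
  have h1 : 7 / 16 * t ^ 2 * |a| ≤ t ^ 2 * |f| + t * (12 * M) := by
    calc 7 / 16 * t ^ 2 * |a| ≤ (t ^ 2 - r ^ 2) * |a| :=
          mul_le_mul_of_nonneg_right (by linarith) (abs_nonneg a)
      _ = |(t ^ 2 - r ^ 2) * a| := by rw [abs_mul, abs_of_nonneg (by nlinarith : 0 ≤ t ^ 2 - r ^ 2)]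
      _ = |t ^ 2 * f + t * S| := by rw [ha]
      _ ≤ |t ^ 2 * f| + |t * S| := abs_add_le _ _
      _ = t ^ 2 * |f| + t * |S| := by
        rw [abs_mul, abs_mul, abs_of_pos ht, abs_of_nonneg (sq_nonneg t)]
      _ ≤ _ := by gcongr
  have hta : t * |a| ≤ 3 * (t * |f|) + 28 * M := by
    have h2 : t * (t * |a|) ≤ t * (3 * (t * |f|) + 28 * M) := by
      nlinarith [mul_nonneg (sq_nonneg t) (abs_nonneg f), mul_nonneg ht.le hM]
    exact le_of_mul_le_mul_left h2 ht
  have hrt : r ≤ t := by linarith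
  have htb : t * |b| ≤ 3 * (t * |f|) + 30 * M := by
    have e : t * b = P - x * a := by rw [hP]; ring
    have : t * |b| ≤ |P| + |x| * |a| := by
      calc t * |b| = |t * b| := by rw [abs_mul, abs_of_pos ht]
        _ ≤ |P| + |x| * |a| := by rw [e, ← abs_mul]; exact abs_sub _ _
    have h3 : |x| * |a| ≤ t * |a| := mul_le_mul_of_nonneg_right (hx.trans hrt) (abs_nonneg a)
    linarith
  have htc : t * |c| ≤ 3 * (t * |f|) + 32 * M := by
    have e : t * c = Q - y * b := by rw [hQ]; ring
    have : t * |c| ≤ |Q| + |y| * |b| := by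
      calc t * |c| = |t * c| := by rw [abs_mul, abs_of_pos ht]
        _ ≤ |Q| + |y| * |b| := by rw [e, ← abs_mul]; exact abs_sub _ _
    have h3 : |y| * |b| ≤ t * |b| := mul_le_mul_of_nonneg_right (hy.trans hrt) (abs_nonneg b)
    linarith
  refine ⟨?_, ?_, ?_⟩
  all_goals
    rw [← mul_le_mul_iff_right₀ ht, mul_add, mul_div_cancel₀ _ ht.ne']
    linarith

/-- The boost fields are the last three of the list. -/
theorem gammaField_boost (u : (Fin 4 → ℝ) → ℝ) (i : Fin 3) :
    GammaField (Fin.natAdd 7 i) u = fun z => z i.succ * pd 0 u z + z 0 * pd i.succ u z := by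
  fin_cases i <;> rfl

theorem pd_gammaField_boost {u : (Fin 4 → ℝ) → ℝ} (hu : Smooth u) (μ : Fin 4) (i : Fin 3)
    (z : Fin 4 → ℝ) :
    pd μ (GammaField (Fin.natAdd 7 i) u) z =
      (if μ = i.succ then 1 else 0) * pd 0 u z + z i.succ * pd μ (pd 0 u) z +
      ((if μ = 0 then 1 else 0) * pd i.succ u z + z 0 * pd μ (pd i.succ u) z) := by
  have h := pd_add ((hu.pd 0).coord_mul i.succ) ((hu.pd i.succ).coord_mul 0) μ
  have h1 := pd_coord_mul (hu.pd 0) μ i.succ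
  have h2 := pd_coord_mul (hu.pd i.succ) μ 0
  rw [gammaField_boost]
  have h' := congrFun h z
  rw [h1, h2] at h'
  exact h'

theorem abs_pd_pd_le_of_boost {u : (Fin 4 → ℝ) → ℝ} (hu : Smooth u) {z : Fin 4 → ℝ} (ht : 0 < z 0)
    (hr : rad z ≤ 3 / 4 * z 0) {M : ℝ} (h1 : ∀ μ, |pd μ u z| ≤ M)
    (h2 : ∀ μ (i : Fin 3), |pd μ (GammaField (Fin.natAdd 7 i) u) z| ≤ M) (μ ν : Fin 4) :
    |pd μ (pd ν u) z| ≤ 3 * |Box u z| + 32 * M / z 0 := by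
  have hM : 0 ≤ M := (abs_nonneg _).trans (h1 0)
  have hr0 : 0 ≤ rad z := Real.sqrt_nonneg _
  have hrsq : rad z ^ 2 = z 1 ^ 2 + z 2 ^ 2 + z 3 ^ 2 := Real.sq_sqrt (by positivity)
  have hx : ∀ i : Fin 3, |z i.succ| ≤ rad z := by
    intro i
    refine abs_le_of_sq_le_sq ?_ hr0
    rw [hrsq]
    fin_cases i <;> simp <;> nlinarith [sq_nonneg (z 1), sq_nonneg (z 2), sq_nonneg (z 3)]
  set P : Fin 3 → ℝ := fun i => pd 0 (GammaField (Fin.natAdd 7 i) u) z - pd i.succ u z with hP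
  set Q : Fin 3 → Fin 3 → ℝ := fun i j => pd j.succ (GammaField (Fin.natAdd 7 i) u) z -
    (if j = i then 1 else 0) * pd 0 u z with hQ
  have hPe : ∀ i, P i = z i.succ * pd 0 (pd 0 u) z + z 0 * pd 0 (pd i.succ u) z := by
    intro i
    simp only [hP, pd_gammaField_boost hu, if_true, (Fin.succ_ne_zero i).symm, if_false]
    ring
  have hQe : ∀ i j, Q i j = z i.succ * pd 0 (pd j.succ u) z + z 0 * pd j.succ (pd i.succ u) z := by
    intro i j
    simp only [hQ, pd_gammaField_boost hu, Fin.succ_inj, Fin.succ_ne_zero, if_false,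
      pd_comm hu j.succ 0]
    ring
  have hPM : ∀ i, |P i| ≤ 2 * M := fun i =>
    (abs_sub _ _).trans (by linarith [h1 i.succ, h2 0 i])
  have hQM : ∀ i j, |Q i j| ≤ 2 * M := fun i j => by
    refine (abs_sub _ _).trans ?_
    have : |(if j = i then 1 else 0) * pd 0 u z| ≤ M := by
      split_ifs
      · simpa using h1 0
      · simpa using hM
    linarith [h2 j.succ i]
  set S : ℝ := Q 0 0 + Q 1 1 + Q 2 2 - (z 1 / z 0 * P 0 + z 2 / z 0 * P 1 + z 3 / z 0 * P 2) with hS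
  have hSM : |S| ≤ 12 * M := by
    have hq : ∀ i : Fin 3, |z i.succ / z 0 * P i| ≤ 2 * M := fun i => by
      rw [abs_mul, abs_div, abs_of_pos ht]
      have : |z i.succ| / z 0 ≤ 1 := (div_le_one ht).2 ((hx i).trans (by linarith))
      nlinarith [hPM i, abs_nonneg (P i)]
    have q0 := abs_le.1 (hq 0)
    have q1 := abs_le.1 (hq 1)
    have q2 := abs_le.1 (hq 2)
    have r0 := abs_le.1 (hQM 0 0)
    have r1 := abs_le.1 (hQM 1 1)
    have r2 := abs_le.1 (hQM 2 2)
    simp only [Fin.succ_zero_eq_one, Fin.succ_one_eq_two,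
      show Fin.succ (2 : Fin 3) = (3 : Fin 4) from rfl] at q0 q1 q2
    exact abs_le.2 ⟨by rw [hS]; linarith, by rw [hS]; linarith⟩
  have ha : (z 0 ^ 2 - rad z ^ 2) * pd 0 (pd 0 u) z = z 0 ^ 2 * Box u z + z 0 * S := by
    have e : z 0 * S = z 0 * (Q 0 0 + Q 1 1 + Q 2 2) - (z 1 * P 0 + z 2 * P 1 + z 3 * P 2) := by
      rw [hS]; field_simp
    rw [e, hPe, hPe, hPe, hQe, hQe, hQe, hrsq]
    simp only [Box, Fin.succ_zero_eq_one, Fin.succ_one_eq_two,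
      show Fin.succ (2 : Fin 3) = (3 : Fin 4) from rfl]
    ring
  have key := fun i j : Fin 3 => abs_hessian_bounds ht hr0 hr hM ha hSM (hx j) (hPe j) (hPM j)
    (hx i) (hQe i j) (hQM i j)
  have hMt : 0 ≤ M / z 0 := div_nonneg hM ht.le
  have e28 : 28 * M / z 0 = 28 * (M / z 0) := mul_div_assoc _ _ _
  have e30 : 30 * M / z 0 = 30 * (M / z 0) := mul_div_assoc _ _ _
  have e32 : 32 * M / z 0 = 32 * (M / z 0) := mul_div_assoc _ _ _
  induction μ using Fin.cases with
  | zero =>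
    induction ν using Fin.cases with
    | zero => linarith [(key 0 0).1]
    | succ j => linarith [(key 0 j).2.1]
  | succ i =>
    induction ν using Fin.cases with
    | zero =>
      rw [pd_comm hu]
      linarith [(key 0 i).2.1]
    | succ j => exact (key j i).2.2

section Chain

variable {m n : ℕ} {Φ : (Fin m → ℝ) → Fin n → ℝ} {u : (Fin n → ℝ) → ℝ}

theorem Smooth.comp_map (hu : Smooth u) (hΦ : ∀ k, Smooth fun y => Φ y k) :
    Smooth fun y => u (Φ y) :=
  ContDiff.comp hu (contDiff_pi.2 hΦ)

theorem pd_comp_map (hu : Smooth u) (hΦ : ∀ k, Smooth fun y => Φ y k) (j : Fin m)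
    (y : Fin m → ℝ) :
    pd j (fun y => u (Φ y)) y = ∑ k, pd j (fun y => Φ y k) y * pd k u (Φ y) := by
  have hd : HasFDerivAt Φ (ContinuousLinearMap.pi fun k => fderiv ℝ (fun y => Φ y k) y) y :=
    hasFDerivAt_pi.2 fun k => ((hΦ k).differentiable y).hasFDerivAt
  have h := ((hu.differentiable (Φ y)).hasFDerivAt.comp y hd).fderiv
  change fderiv ℝ (u ∘ Φ) y (Pi.single j 1) = _
  rw [h, ContinuousLinearMap.comp_apply]
  conv_lhs => rw [pi_eq_sum_univ' ((ContinuousLinearMap.pi fun k => fderiv ℝ (fun y => Φ y k) y)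
    (Pi.single j 1))]
  rw [map_sum]
  refine Finset.sum_congr rfl fun k _ => ?_
  rw [map_smul, smul_eq_mul]
  simp only [pd, ContinuousLinearMap.pi_apply]

end Chain

theorem smooth_cons_coord (t : ℝ) (k : Fin 4) :
    Smooth fun y : Fin 3 → ℝ => (Fin.cons t y : Fin 4 → ℝ) k := by
  refine Fin.cases ?_ (fun j => ?_) k
  · exact contDiff_const
  · exact smooth_coord j

theorem Smooth.slice {u : (Fin 4 → ℝ) → ℝ} (hu : Smooth u) (t : ℝ) :
    Smooth fun y : Fin 3 → ℝ => u (Fin.cons t y) :=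
  hu.comp_map (smooth_cons_coord t)

theorem pd_slice {u : (Fin 4 → ℝ) → ℝ} (hu : Smooth u) (t : ℝ) (j : Fin 3) :
    pd j (fun y : Fin 3 → ℝ => u (Fin.cons t y)) = fun y => pd j.succ u (Fin.cons t y) := by
  funext y
  rw [pd_comp_map hu (smooth_cons_coord t), Fin.sum_univ_succ]
  have h0 : pd j (fun y : Fin 3 → ℝ => (Fin.cons t y : Fin 4 → ℝ) 0) y = 0 := by
    simp [pd]
  have hs : ∀ k : Fin 3, pd j (fun y : Fin 3 → ℝ => (Fin.cons t y : Fin 4 → ℝ) k.succ) y =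
      if k = j then 1 else 0 := by
    intro k
    have : HasFDerivAt (fun y : Fin 3 → ℝ => y k) (ContinuousLinearMap.proj (R := ℝ) k) y :=
      (ContinuousLinearMap.proj (R := ℝ) (φ := fun _ : Fin 3 => ℝ) k).hasFDerivAt
    simp [pd, this.fderiv, Pi.single_apply]
  simp only [h0, hs]
  simp

theorem gammaField_translation (u : (Fin 4 → ℝ) → ℝ) (μ : Fin 4) :
    GammaField (Fin.castLE (by norm_num) μ) u = pd μ u := by
  fin_cases μ <;> rfl

section Interior

variable {w : (Fin 4 → ℝ) → ℝ} {z : Fin 4 → ℝ}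

theorem abs_pd_pd_le (hw : Smooth w) (ht : 0 < z 0) (hr : rad z ≤ 3 / 4 * z 0) (μ ν : Fin 4) :
    |pd μ (pd ν w) z| ≤ 3 * sourceSum (Box w) z + 32 * gradSum w z / z 0 := by
  refine (abs_pd_pd_le_of_boost hw ht hr (M := gradSum w z)
    (fun μ => abs_pd_opIter_le_gradSum w (L := []) (by simp) μ z)
    (fun μ i => abs_pd_opIter_le_gradSum w (L := [Fin.natAdd 7 i]) (by simp) μ z) μ ν).trans ?_
  have := abs_opIter_le_sourceSum (Box w) (L := []) (by simp) z
  simp only [opIter, id] at this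
  linarith

theorem abs_pd_pd_pd_le (hw : Smooth w) (ht : 0 < z 0) (hr : rad z ≤ 3 / 4 * z 0)
    (κ μ ν : Fin 4) :
    |pd κ (pd μ (pd ν w)) z| ≤ 3 * sourceSum (Box w) z + 32 * gradSum w z / z 0 := by
  rw [← gammaField_translation w ν]
  set l : Fin 10 := Fin.castLE (by norm_num) ν
  refine (abs_pd_pd_le_of_boost (hw.gammaField l) ht hr (M := gradSum w z)
    (fun μ => abs_pd_opIter_le_gradSum w (L := [l]) (by simp) μ z)
    (fun μ i => abs_pd_opIter_le_gradSum w (L := [Fin.natAdd 7 i, l]) (by simp) μ z) κ μ).trans ?_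
  have := abs_opIter_le_sourceSum (Box w) (L := [l]) (by simp) z
  rw [← box_opIter hw] at this
  simp only [opIter, id] at this
  linarith

theorem rad_cons_add_le {t : ℝ} {x y : Fin 3 → ℝ} (ht : 0 ≤ t) (hx : rad (Fin.cons t x) ≤ t / 2)
    (hy : y ∈ Set.Icc x fun i => x i + t / 8) : rad (Fin.cons t y) ≤ 3 / 4 * t := by
  rw [rad_cons, Real.sqrt_le_left (by linarith)] at hx ⊢
  have h : ∀ i, y i ^ 2 ≤ 7 / 5 * x i ^ 2 + 7 / 2 * (t / 8) ^ 2 := fun i => by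
    have h1 := hy.1 i
    have h2 := hy.2 i
    simp only at h2
    have h3 : (y i - x i) ^ 2 ≤ (t / 8) ^ 2 := pow_le_pow_left₀ (by linarith) (by linarith) 2
    nlinarith [sq_nonneg (2 * x i - 5 * (y i - x i))]
  nlinarith [h 0, h 1, h 2]

theorem interior_estimate {B : ℝ} (hB : 0 < B) : ∃ C : ℝ, 0 ≤ C ∧
    ∀ w : (Fin 4 → ℝ) → ℝ, Smooth w → (∀ z : Fin 4 → ℝ, z 0 ≤ 2*B → w z = 0) →
      (∀ z : Fin 4 → ℝ, rad z > z 0 - B → Box w z = 0) → ∀ t : ℝ, 2*B ≤ t →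
      ∀ x : Fin 3 → ℝ, rad (Fin.cons t x) ≤ t / 2 → ∀ μ : Fin 4,
        t * |pd μ w (Fin.cons t x)| ≤ C * dyadicSum (Box w) B t := by
  obtain ⟨K₁, eK₁⟩ : ∃ K : ℝ, K = ((Fintype.card (Word × Fin 4) : ℕ) : ℝ) := ⟨_, rfl⟩
  obtain ⟨K₂, eK₂⟩ : ∃ K : ℝ, K = ((Fintype.card Word : ℕ) : ℝ) := ⟨_, rfl⟩
  have hK₁ : 0 ≤ K₁ := eK₁ ▸ Nat.cast_nonneg _
  have hK₂ : 0 ≤ K₂ := eK₂ ▸ Nat.cast_nonneg _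
  set A : ℝ := 10 * K₂ + 200 * K₁ with hA
  have hA0 : 0 ≤ A := by positivity
  set β : ℝ := (B / 4) ^ (-(1 / 2) : ℝ) with hβ
  set γ : ℝ := (B / 4) ^ (1 / 2 : ℝ) with hγ
  have hβ0 : 0 ≤ β := Real.rpow_nonneg (by linarith) _
  have hγ0 : 0 ≤ γ := Real.rpow_nonneg (by linarith) _
  refine ⟨32 * K₁ * β + 9 * A * β + 18 * A * γ, by positivity, ?_⟩
  intro w hw hvan hsupp t hBt x hx μ
  have ht : 0 < t := by linarith
  set D := dyadicSum (Box w) B t with hD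
  have hD0 : 0 ≤ D := dyadicSum_nonneg _ _ _
  set Q := Set.Icc x fun i => x i + t / 8 with hQ
  have hQc : IsCompact Q := isCompact_Icc
  have hQsub : Q ⊆ Set.Icc (fun _ : Fin 3 => -t) (fun _ => t) := fun y hy =>
    mem_Icc_of_rad_le ((rad_cons_add_le ht.le hx hy).trans (by linarith))
  set S₁ : (Fin 3 → ℝ) → ℝ := fun y => gradSum w (Fin.cons t y) with hS₁
  set S₂ : (Fin 3 → ℝ) → ℝ := fun y => sourceSum (Box w) (Fin.cons t y) with hS₂
  have cS₁ : Continuous S₁ := continuous_gradSum_slice hw t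
  have cS₂ : Continuous S₂ := continuous_sourceSum_slice hw.box t
  have sub : ∀ f : (Fin 3 → ℝ) → ℝ, Continuous f →
      ∫ y in Q, f y ^ 2 ≤ ∫ y in Set.Icc (fun _ : Fin 3 => -t) (fun _ => t), f y ^ 2 :=
    fun f hf => setIntegral_mono_set ((hf.pow 2).continuousOn.integrableOn_compact isCompact_Icc)
      (Filter.Eventually.of_forall fun _ => sq_nonneg _) (Filter.Eventually.of_forall hQsub)
  have i₁ : ∫ y in Q, S₁ y ^ 2 ≤ (K₁ * (4 * D)) ^ 2 :=
    (sub S₁ cS₁).trans (eK₁ ▸ integral_gradSum_sq_le hw hB hBt hvan hsupp ht.le)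
  have i₂ : ∫ y in Q, S₂ y ^ 2 ≤ (K₂ * (2 * D / t)) ^ 2 :=
    (sub S₂ cS₂).trans (eK₂ ▸ integral_sourceSum_sq_le hw hB hBt hsupp t)
  have hG : ∫ y in Q, (3 * S₂ y + 32 * S₁ y / t) ^ 2 ≤ (A * D / t) ^ 2 := by
    have int₁ : IntegrableOn (fun y => 2048 / t ^ 2 * S₁ y ^ 2) Q :=
      ((cS₁.pow 2).const_mul _).continuousOn.integrableOn_compact hQc
    have int₂ : IntegrableOn (fun y => 18 * S₂ y ^ 2) Q :=
      ((cS₂.pow 2).const_mul _).continuousOn.integrableOn_compact hQc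
    calc ∫ y in Q, (3 * S₂ y + 32 * S₁ y / t) ^ 2
        ≤ ∫ y in Q, (18 * S₂ y ^ 2 + 2048 / t ^ 2 * S₁ y ^ 2) := by
          refine integral_mono ?_ (int₂.add int₁) fun y => ?_
          · exact (((cS₂.const_mul 3).add ((cS₁.const_mul 32).div_const t)).pow
              2).continuousOn.integrableOn_compact hQc
          · have : 2048 / t ^ 2 * S₁ y ^ 2 = 2 * (32 * S₁ y / t) ^ 2 := by field_simp; ring
            simp only
            rw [this]
            nlinarith [sq_nonneg (3 * S₂ y - 32 * S₁ y / t)]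
      _ = 18 * (∫ y in Q, S₂ y ^ 2) + (2048 / t ^ 2) * ∫ y in Q, S₁ y ^ 2 := by
          rw [integral_add int₂ int₁, integral_const_mul, integral_const_mul]
      _ ≤ 18 * (K₂ * (2 * D / t)) ^ 2 + (2048 / t ^ 2) * (K₁ * (4 * D)) ^ 2 := by gcongr
      _ = (72 * K₂ ^ 2 + 32768 * K₁ ^ 2) * (D / t) ^ 2 := by field_simp; ring
      _ ≤ A ^ 2 * (D / t) ^ 2 := by
          gcongr
          rw [hA]
          nlinarith [mul_nonneg hK₁ hK₂, sq_nonneg K₁, sq_nonneg K₂]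
      _ = (A * D / t) ^ 2 := by ring
  have cG : Continuous fun y => 3 * S₂ y + 32 * S₁ y / t :=
    (cS₂.const_mul 3).add ((cS₁.const_mul 32).div_const t)
  have bound : ∀ (f : (Fin 3 → ℝ) → ℝ) (k : ℝ), Continuous f → (∀ y, 0 ≤ f y) →
      (∀ y ∈ Q, f y ≤ k * (3 * S₂ y + 32 * S₁ y / t)) →
      ∫ y in Q, f y ^ 2 ≤ (k * (A * D / t)) ^ 2 := by
    intro f k hf hf0 hle
    calc ∫ y in Q, f y ^ 2 ≤ ∫ y in Q, k ^ 2 * (3 * S₂ y + 32 * S₁ y / t) ^ 2 := by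
          refine setIntegral_mono_on ((hf.pow 2).continuousOn.integrableOn_compact hQc)
            (((cG.pow 2).const_mul _).continuousOn.integrableOn_compact hQc) measurableSet_Icc
            fun y hy => ?_
          rw [← mul_pow]
          exact pow_le_pow_left₀ (hf0 y) (hle y hy) 2
      _ ≤ k ^ 2 * (A * D / t) ^ 2 := by rw [integral_const_mul]; gcongr
      _ = _ := by ring
  set V : (Fin 3 → ℝ) → ℝ := fun y => pd μ w (Fin.cons t y) with hVdef
  have hV : Smooth V := (hw.pd μ).slice t
  have h₀ : ∫ y in Q, |V y| ^ 2 ≤ (K₁ * (4 * D)) ^ 2 := by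
    refine le_trans ?_ i₁
    refine integral_mono ((hV.continuous.abs.pow 2).continuousOn.integrableOn_compact hQc)
      ((cS₁.pow 2).continuousOn.integrableOn_compact hQc) fun y => ?_
    exact pow_le_pow_left₀ (abs_nonneg _)
      (abs_pd_opIter_le_gradSum w (L := []) (by simp) μ (Fin.cons t y)) 2
  have hrad : ∀ y ∈ Q, rad (Fin.cons t y) ≤ 3 / 4 * (Fin.cons t y : Fin 4 → ℝ) 0 :=
    fun y hy => rad_cons_add_le ht.le hx hy
  have h₁ : ∫ y in Q, (∑ i, |pd i V y|) ^ 2 ≤ (3 * (A * D / t)) ^ 2 := by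
    refine bound _ 3 (continuous_finsetSum _ fun i _ => (hV.pd i).continuous.abs)
      (fun y => Finset.sum_nonneg fun _ _ => abs_nonneg _) fun y hy => ?_
    refine (Finset.sum_le_card_nsmul _ _ (3 * S₂ y + 32 * S₁ y / t) fun i _ => ?_).trans
      (by simp; linarith)
    rw [hVdef, pd_slice (hw.pd μ)]
    exact abs_pd_pd_le hw (z := Fin.cons t y) ht (hrad y hy) i.succ μ
  have h₂ : ∫ y in Q, (∑ i, ∑ j, |pd j (pd i V) y|) ^ 2 ≤ (9 * (A * D / t)) ^ 2 := by
    refine bound _ 9 (continuous_finsetSum _ fun i _ => continuous_finsetSum _ fun j _ =>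
      ((hV.pd i).pd j).continuous.abs)
      (fun y => Finset.sum_nonneg fun _ _ => Finset.sum_nonneg fun _ _ => abs_nonneg _)
      fun y hy => ?_
    refine (Finset.sum_le_card_nsmul _ _ (3 * (3 * S₂ y + 32 * S₁ y / t)) fun i _ => ?_).trans
      (by simp; linarith)
    refine (Finset.sum_le_card_nsmul _ _ (3 * S₂ y + 32 * S₁ y / t) fun j _ => ?_).trans
      (by simp; linarith)
    rw [hVdef, pd_slice (hw.pd μ), pd_slice ((hw.pd μ).pd i.succ)]
    exact abs_pd_pd_pd_le hw (z := Fin.cons t y) ht (hrad y hy) j.succ i.succ μ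
  have key := sobolev_cube hV x (a := B / 4) (R := t / 8) (by linarith) (by linarith)
    (by positivity) (by positivity) (by positivity) h₀ h₁ h₂
  have hpow : t * (t / 8) ^ (-(3 / 2) : ℝ) ≤ 8 * β := by
    have e : (t / 8) ^ (-(3 / 2) : ℝ) = (t / 8) ^ (-1 : ℝ) * (t / 8) ^ (-(1 / 2) : ℝ) := by
      rw [← Real.rpow_add (by linarith)]; norm_num
    have h2 : (t / 8) ^ (-(1 / 2) : ℝ) ≤ β :=
      Real.rpow_le_rpow_of_nonpos (by linarith) (by linarith) (by norm_num)
    have e3 : t * (t / 8)⁻¹ = 8 := by field_simp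
    rw [e, Real.rpow_neg_one, ← mul_assoc, e3]
    linarith
  have hVx : t * |V x| ≤ t * ((t / 8) ^ (-(3 / 2) : ℝ) * (K₁ * (4 * D)) +
      3 * β * (3 * (A * D / t)) + 2 * γ * (9 * (A * D / t))) :=
    mul_le_mul_of_nonneg_left key ht.le
  have e : t * ((t / 8) ^ (-(3 / 2) : ℝ) * (K₁ * (4 * D)) +
      3 * β * (3 * (A * D / t)) + 2 * γ * (9 * (A * D / t))) =
      (t * (t / 8) ^ (-(3 / 2) : ℝ)) * (K₁ * (4 * D)) + 9 * A * β * D + 18 * A * γ * D := by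
    generalize (t / 8) ^ (-(3 / 2) : ℝ) = q
    field_simp
    ring
  have h5 := mul_le_mul_of_nonneg_right hpow (by positivity : 0 ≤ K₁ * (4 * D))
  rw [e] at hVx
  calc t * |pd μ w (Fin.cons t x)| ≤ _ := hVx
    _ ≤ 8 * β * (K₁ * (4 * D)) + 9 * A * β * D + 18 * A * γ * D := by linarith
    _ = _ := by ring

end Interior

/-- The fields `GammaField` have affine coefficients. -/
theorem exists_gammaField_eq_sum (l : Fin 10) : ∃ (α : Fin 4 → ℝ) (κ : Fin 4 → Fin 4 → ℝ),
    (∀ ν m, |κ ν m| ≤ 1) ∧ ∀ (u : (Fin 4 → ℝ) → ℝ) (z : Fin 4 → ℝ),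
      GammaField l u z = ∑ ν, (α ν + ∑ m, κ ν m * z m) * pd ν u z := by
  have htr : ∀ μ : Fin 4, ∃ (α : Fin 4 → ℝ) (κ : Fin 4 → Fin 4 → ℝ),
      (∀ ν m, |κ ν m| ≤ 1) ∧ ∀ (u : (Fin 4 → ℝ) → ℝ) (z : Fin 4 → ℝ),
      pd μ u z = ∑ ν, (α ν + ∑ m, κ ν m * z m) * pd ν u z := fun μ =>
    ⟨fun ν => if ν = μ then 1 else 0, fun _ _ => 0, by simp, by simp⟩
  have hlin : ∀ (s : ℝ) (i j : Fin 4), |s| = 1 → i ≠ j → ∃ (α : Fin 4 → ℝ) (κ : Fin 4 → Fin 4 → ℝ),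
      (∀ ν m, |κ ν m| ≤ 1) ∧ ∀ (u : (Fin 4 → ℝ) → ℝ) (z : Fin 4 → ℝ),
      z i * pd j u z + s * (z j * pd i u z) = ∑ ν, (α ν + ∑ m, κ ν m * z m) * pd ν u z := by
    intro s i j hs hij
    refine ⟨fun _ => 0, fun ν m => (if ν = j then if m = i then 1 else 0 else 0) +
      if ν = i then if m = j then s else 0 else 0, fun ν m => ?_, fun u z => ?_⟩
    · beta_reduce
      by_cases h1 : ν = j
      · subst h1
        rw [if_neg (Ne.symm hij), add_zero, if_pos rfl]
        split_ifs <;> simp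
      · rw [if_neg h1, zero_add]
        split_ifs <;> simp [hs]
    · simp only [zero_add, add_mul, Finset.sum_add_distrib, ite_mul, zero_mul, one_mul,
        Finset.sum_ite_irrel, Finset.sum_ite_eq', Finset.mem_univ, if_true, Finset.sum_const_zero]
      ring
  have hrot := fun i j h => hlin (-1) i j (by simp) h
  have hboost := fun i j h => hlin 1 i j (by simp) h
  simp only [neg_mul, one_mul, ← sub_eq_add_neg] at hrot
  simp only [one_mul] at hboost
  fin_cases l
  · exact htr 0
  · exact htr 1
  · exact htr 2
  · exact htr 3
  · exact hrot 1 2 (by decide)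
  · exact hrot 1 3 (by decide)
  · exact hrot 2 3 (by decide)
  · exact hboost 1 0 (by decide)
  · exact hboost 2 0 (by decide)
  · exact hboost 3 0 (by decide)

theorem pd_sum {n : ℕ} {ι : Type*} (s : Finset ι) {f : ι → (Fin n → ℝ) → ℝ}
    (hf : ∀ i, Smooth (f i)) (j : Fin n) (z : Fin n → ℝ) :
    pd j (fun z => ∑ i ∈ s, f i z) z = ∑ i ∈ s, pd j (f i) z := by
  simp only [pd]
  rw [fderiv_fun_sum fun i _ => (hf i).differentiable z, sum_apply]

theorem pd_const_mul {n : ℕ} {f : (Fin n → ℝ) → ℝ} (hf : Smooth f) (c : ℝ) (j : Fin n)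
    (z : Fin n → ℝ) : pd j (fun z => c * f z) z = c * pd j f z := by
  simp only [pd]
  rw [fderiv_const_mul (hf.differentiable z)]
  rfl

theorem gammaField_add {u v : (Fin 4 → ℝ) → ℝ} (hu : Smooth u) (hv : Smooth v) (l : Fin 10)
    (z : Fin 4 → ℝ) :
    GammaField l (fun z => u z + v z) z = GammaField l u z + GammaField l v z := by
  obtain ⟨α, κ, -, h⟩ := exists_gammaField_eq_sum l
  simp only [h, pd_add hu hv, mul_add, Finset.sum_add_distrib]

theorem gammaField_sum_const_mul {f : Fin 4 → (Fin 4 → ℝ) → ℝ} (hf : ∀ i, Smooth (f i))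
    (c : Fin 4 → ℝ) (l : Fin 10) (z : Fin 4 → ℝ) :
    GammaField l (fun z => ∑ ν, c ν * f ν z) z = ∑ ν, c ν * GammaField l (f ν) z := by
  obtain ⟨α, κ, -, h⟩ := exists_gammaField_eq_sum l
  have hs : ∀ i, Smooth fun z => c i * f i z := fun i => contDiff_const.mul (hf i)
  simp only [h, pd_sum _ hs, pd_const_mul (hf _), Finset.mul_sum]
  rw [Finset.sum_comm]
  refine Finset.sum_congr rfl fun i _ => Finset.sum_congr rfl fun j _ => ?_
  ring

/-- The commutator of a field with a coordinate derivative has bounded constant coefficients. -/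
theorem exists_gammaField_pd (l : Fin 10) (μ : Fin 4) : ∃ c : Fin 4 → ℝ, (∀ ν, |c ν| ≤ 1) ∧
    ∀ u : (Fin 4 → ℝ) → ℝ, Smooth u →
      GammaField l (pd μ u) = fun z => pd μ (GammaField l u) z + ∑ ν, c ν * pd ν u z := by
  obtain ⟨α, κ, hκ, h⟩ := exists_gammaField_eq_sum l
  refine ⟨fun ν => -κ ν μ, fun ν => by simpa using hκ ν μ, fun u hu => funext fun z => ?_⟩
  have ha : ∀ ν, Smooth fun z : Fin 4 → ℝ => α ν + ∑ m, κ ν m * z m := fun ν =>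
    contDiff_const.add (ContDiff.sum fun m _ => contDiff_const.mul (smooth_coord m))
  have hpa : ∀ ν, pd μ (fun z : Fin 4 → ℝ => α ν + ∑ m, κ ν m * z m) z = κ ν μ := by
    intro ν
    have hd : HasFDerivAt (fun z : Fin 4 → ℝ => α ν + ∑ m, κ ν m * z m)
        (∑ m, κ ν m • ContinuousLinearMap.proj (R := ℝ) (φ := fun _ : Fin 4 => ℝ) m) z :=
      (HasFDerivAt.fun_sum fun m _ => (ContinuousLinearMap.proj (R := ℝ)
        (φ := fun _ : Fin 4 => ℝ) m).hasFDerivAt.const_mul (κ ν m)).const_add _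
    simp [pd, hd.fderiv, Pi.single_apply]
  have e : GammaField l u = fun z => ∑ ν, (α ν + ∑ m, κ ν m * z m) * pd ν u z := funext (h u)
  have hsm : ∀ ν, Smooth fun z => (α ν + ∑ m, κ ν m * z m) * pd ν u z := fun ν =>
    ContDiff.mul (ha ν) (hu.pd ν)
  rw [h, e, pd_sum _ hsm, ← Finset.sum_add_distrib]
  refine Finset.sum_congr rfl fun ν _ => ?_
  rw [pd_mul ((ha ν).differentiable z) ((hu.pd ν).differentiable z), hpa, pd_comm hu μ ν]
  ring

section Commuted

variable {w : (Fin 4 → ℝ) → ℝ}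

theorem abs_sum_mul_le {c f : Fin 4 → ℝ} {M : ℝ} (hc : ∀ ν, |c ν| ≤ 1) (hf : ∀ ν, |f ν| ≤ M) :
    |∑ ν, c ν * f ν| ≤ 4 * M := by
  refine (Finset.abs_sum_le_sum_abs _ _).trans
    ((Finset.sum_le_card_nsmul _ _ M fun ν _ => ?_).trans (by simp))
  rw [abs_mul]
  exact (mul_le_of_le_one_left (abs_nonneg _) (hc ν)).trans (hf ν)

theorem abs_gammaField_pd_le (hw : Smooth w) (l : Fin 10) (μ : Fin 4) (z : Fin 4 → ℝ) :
    |GammaField l (pd μ w) z| ≤ 5 * gradSum w z := by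
  obtain ⟨c, hc, h⟩ := exists_gammaField_pd l μ
  rw [h w hw]
  have h1 := abs_pd_opIter_le_gradSum w (L := [l]) (by simp) μ z
  have h2 := abs_sum_mul_le (f := fun ν => pd ν w z) hc
    fun ν => abs_pd_opIter_le_gradSum w (L := []) (by simp) ν z
  exact (abs_add_le _ _).trans (by simp only [opIter, id] at h1; linarith)

theorem abs_gammaField_gammaField_pd_le (hw : Smooth w) (m l : Fin 10) (μ : Fin 4)
    (z : Fin 4 → ℝ) : |GammaField m (GammaField l (pd μ w)) z| ≤ 25 * gradSum w z := by
  obtain ⟨c, hc, h⟩ := exists_gammaField_pd l μ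
  obtain ⟨c', hc', h'⟩ := exists_gammaField_pd m μ
  rw [h w hw, gammaField_add ((hw.gammaField l).pd μ)
    (ContDiff.sum fun ν _ => contDiff_const.mul (hw.pd ν)),
    gammaField_sum_const_mul hw.pd, h' _ (hw.gammaField l)]
  have h1 := abs_pd_opIter_le_gradSum w (L := [m, l]) (by simp) μ z
  have h2 := abs_sum_mul_le (f := fun ν => pd ν (GammaField l w) z) hc'
    fun ν => abs_pd_opIter_le_gradSum w (L := [l]) (by simp) ν z
  have h3 := abs_sum_mul_le (f := fun ν => GammaField m (pd ν w) z) hc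
    fun ν => abs_gammaField_pd_le hw m ν z
  simp only [opIter, id] at h1
  have h4 := abs_add_le (pd μ (GammaField m (GammaField l w)) z)
    (∑ ν, c' ν * pd ν (GammaField l w) z)
  exact (abs_add_le _ _).trans (by beta_reduce; linarith)

end Commuted

/-- Spherical coordinates `(ρ, a, b)` on `ℝ³`, with `b` the latitude. -/
def sph (p : Fin 3 → ℝ) : Fin 3 → ℝ :=
  ![p 0 * (Real.cos (p 1) * Real.cos (p 2)), p 0 * (Real.sin (p 1) * Real.cos (p 2)),
    p 0 * Real.sin (p 2)]

/-- The Jacobian matrix of `sph`. -/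
def sphJacobian (p : Fin 3 → ℝ) : Matrix (Fin 3) (Fin 3) ℝ :=
  !![Real.cos (p 1) * Real.cos (p 2), -(p 0 * (Real.sin (p 1) * Real.cos (p 2))),
      -(p 0 * (Real.cos (p 1) * Real.sin (p 2)));
    Real.sin (p 1) * Real.cos (p 2), p 0 * (Real.cos (p 1) * Real.cos (p 2)),
      -(p 0 * (Real.sin (p 1) * Real.sin (p 2)));
    Real.sin (p 2), 0, p 0 * Real.cos (p 2)]

/-- Spherical coordinates with the axes permuted by `e`. -/
def sphChart (e : Equiv.Perm (Fin 3)) (p : Fin 3 → ℝ) : Fin 3 → ℝ := fun i => sph p (e.symm i)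

theorem det_sphJacobian (p : Fin 3 → ℝ) : (sphJacobian p).det = p 0 ^ 2 * Real.cos (p 2) := by
  rw [Matrix.det_fin_three]
  simp only [sphJacobian, Matrix.of_apply, Matrix.cons_val', Matrix.cons_val_zero,
    Matrix.cons_val_one, Matrix.cons_val]
  have ha := Real.sin_sq_add_cos_sq (p 1)
  have hb := Real.sin_sq_add_cos_sq (p 2)
  linear_combination (p 0 ^ 2 * Real.cos (p 2) * (Real.cos (p 2) ^ 2 + Real.sin (p 2) ^ 2)) * ha +
    p 0 ^ 2 * Real.cos (p 2) * hb

theorem smooth_sph (i : Fin 3) : Smooth fun p => sph p i := by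
  have h : ∀ j : Fin 3, Smooth fun p : Fin 3 → ℝ => p j := smooth_coord
  fin_cases i
  · exact (h 0).mul ((h 1).cos.mul (h 2).cos)
  · exact (h 0).mul ((h 1).sin.mul (h 2).cos)
  · exact (h 0).mul (h 2).sin

theorem hasFDerivAt_sphChart (e : Equiv.Perm (Fin 3)) (p : Fin 3 → ℝ) :
    HasFDerivAt (sphChart e) (LinearMap.toContinuousLinearMap
      (Matrix.toLin' ((sphJacobian p).submatrix e.symm id))) p := by
  rw [hasFDerivAt_pi']
  intro k
  have h : ∀ j : Fin 3, HasFDerivAt (fun p : Fin 3 → ℝ => p j)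
      (ContinuousLinearMap.proj (R := ℝ) (φ := fun _ : Fin 3 => ℝ) j) p := fun j =>
    (ContinuousLinearMap.proj (R := ℝ) (φ := fun _ : Fin 3 => ℝ) j).hasFDerivAt
  have key : ∀ i : Fin 3, HasFDerivAt (fun p => sph p i) (LinearMap.toContinuousLinearMap
      (LinearMap.proj i ∘ₗ Matrix.toLin' (sphJacobian p))) p := by
    intro i
    fin_cases i
    · refine ((h 0).mul ((h 1).cos.mul (h 2).cos)).congr_fderiv ?_
      ext v
      simp [sphJacobian, Matrix.mulVec, dotProduct, Fin.sum_univ_three]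
      ring
    · refine ((h 0).mul ((h 1).sin.mul (h 2).cos)).congr_fderiv ?_
      ext v
      simp [sphJacobian, Matrix.mulVec, dotProduct, Fin.sum_univ_three]
      ring
    · refine ((h 0).mul (h 2).sin).congr_fderiv ?_
      ext v
      simp [sphJacobian, Matrix.mulVec, dotProduct, Fin.sum_univ_three]
      ring
  refine (key (e.symm k)).congr_fderiv ?_
  ext v
  simp [Matrix.mulVec, dotProduct]

theorem pd_sphChart (e : Equiv.Perm (Fin 3)) (i j : Fin 3) (p : Fin 3 → ℝ) :
    pd j (fun p => sphChart e p i) p = sphJacobian p (e.symm i) j := by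
  have h := hasFDerivAt_pi'.1 (hasFDerivAt_sphChart e p) i
  simp [pd, h.fderiv]

theorem sum_sph_sq (p : Fin 3 → ℝ) : sph p 0 ^ 2 + sph p 1 ^ 2 + sph p 2 ^ 2 = p 0 ^ 2 := by
  simp only [sph, Matrix.cons_val_zero, Matrix.cons_val_one, Matrix.cons_val]
  have ha := Real.sin_sq_add_cos_sq (p 1)
  have hb := Real.sin_sq_add_cos_sq (p 2)
  linear_combination p 0 ^ 2 * Real.cos (p 2) ^ 2 * ha + p 0 ^ 2 * hb

theorem abs_sph_le {p : Fin 3 → ℝ} (hp : 0 ≤ p 0) (i : Fin 3) : |sph p i| ≤ p 0 := by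
  refine abs_le_of_sq_le_sq ?_ hp
  have := sum_sph_sq p
  fin_cases i <;> simp <;> nlinarith [sq_nonneg (sph p 0), sq_nonneg (sph p 1), sq_nonneg (sph p 2)]

theorem cos_latitude_ge {b₀ b : ℝ} (hb₀ : |b₀| ≤ Real.pi / 4) (h1 : b₀ ≤ b) (h2 : b ≤ b₀ + 1 / 4) :
    1 / 3 ≤ Real.cos b ∧ |b| < Real.pi / 2 := by
  have hπ := Real.pi_lt_d2
  have hπ' := Real.pi_gt_d2
  obtain ⟨h3, h4⟩ := abs_le.1 hb₀
  have hb : |b| ≤ 1.04 := abs_le.2 ⟨by norm_num at *; linarith, by norm_num at *; linarith⟩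
  refine ⟨?_, by norm_num at *; linarith⟩
  have h5 := Real.one_sub_sq_div_two_le_cos (x := b)
  have h6 : b ^ 2 ≤ 1.04 ^ 2 := sq_le_sq' (by linarith [(abs_le.1 hb).1]) (abs_le.1 hb).2
  norm_num at *
  linarith

theorem injOn_sph {r a b : ℝ} (hr : 0 < r) (hb : |b| ≤ Real.pi / 4) :
    Set.InjOn sph (Set.Icc ![r, a, b] fun i => ![r, a, b] i + 1 / 4) := by
  intro p hp q hq h
  have hπ' := Real.pi_gt_d2
  have pl : r ≤ p 0 := hp.1 0
  have ql : r ≤ q 0 := hq.1 0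
  have p1l : a ≤ p 1 := hp.1 1
  have p1u : p 1 ≤ a + 1 / 4 := hp.2 1
  have q1l : a ≤ q 1 := hq.1 1
  have q1u : q 1 ≤ a + 1 / 4 := hq.2 1
  obtain ⟨cp, bp⟩ := cos_latitude_ge hb (show b ≤ p 2 from hp.1 2)
    (show p 2 ≤ b + 1 / 4 from hp.2 2)
  obtain ⟨cq, bq⟩ := cos_latitude_ge hb (show b ≤ q 2 from hq.1 2)
    (show q 2 ≤ b + 1 / 4 from hq.2 2)
  have e0 : p 0 = q 0 := by
    have h1 := sum_sph_sq p
    rw [h, sum_sph_sq q] at h1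
    nlinarith
  have hp0 : q 0 ≠ 0 := by linarith
  have c0 : p 0 * (Real.cos (p 1) * Real.cos (p 2)) = q 0 * (Real.cos (q 1) * Real.cos (q 2)) :=
    congrFun h 0
  have c1 : p 0 * (Real.sin (p 1) * Real.cos (p 2)) = q 0 * (Real.sin (q 1) * Real.cos (q 2)) :=
    congrFun h 1
  have c2 : p 0 * Real.sin (p 2) = q 0 * Real.sin (q 2) := congrFun h 2
  rw [e0] at c0 c1 c2
  have e2 : p 2 = q 2 := Real.injOn_sin
    ⟨(abs_lt.1 bp).1.le.trans' (by linarith), (abs_lt.1 bp).2.le⟩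
    ⟨(abs_lt.1 bq).1.le.trans' (by linarith), (abs_lt.1 bq).2.le⟩ (mul_left_cancel₀ hp0 c2)
  have hcq : Real.cos (q 2) ≠ 0 := by linarith
  rw [e2] at c0 c1
  have c0' := mul_right_cancel₀ hcq (mul_left_cancel₀ hp0 c0)
  have c1' := mul_right_cancel₀ hcq (mul_left_cancel₀ hp0 c1)
  have e1 : p 1 = q 1 := by
    have hs : Real.sin (p 1 - q 1) = 0 := by rw [Real.sin_sub, c0', c1']; ring
    have := (Real.sin_eq_zero_iff_of_lt_of_lt (by norm_num at *; linarith)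
      (by norm_num at *; linarith)).1 hs
    linarith
  funext i
  fin_cases i
  exacts [e0, e1, e2]

theorem injOn_sphChart (e : Equiv.Perm (Fin 3)) {r a b : ℝ} (hr : 0 < r) (hb : |b| ≤ Real.pi / 4) :
    Set.InjOn (sphChart e) (Set.Icc ![r, a, b] fun i => ![r, a, b] i + 1 / 4) := by
  intro p hp q hq h
  refine injOn_sph hr hb hp hq (funext fun i => ?_)
  have := congrFun h (e i)
  simpa [sphChart] using this

theorem continuous_sphChart (e : Equiv.Perm (Fin 3)) : Continuous (sphChart e) :=
  continuous_pi fun i => (smooth_sph (e.symm i)).continuous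

theorem integral_sphChart_sq_le (e : Equiv.Perm (Fin 3)) {g : (Fin 3 → ℝ) → ℝ} (hg : Continuous g)
    {r a b : ℝ} (hr : 0 < r) (hb : |b| ≤ Real.pi / 4) :
    r ^ 2 / 3 * ∫ p in Set.Icc ![r, a, b] (fun i => ![r, a, b] i + 1 / 4), g (sphChart e p) ^ 2 ≤
      ∫ y in Set.Icc (fun _ : Fin 3 => -(r + 1 / 4)) (fun _ => r + 1 / 4), g y ^ 2 := by
  set Q := Set.Icc ![r, a, b] (fun i => ![r, a, b] i + 1 / 4) with hQ
  have hQc : IsCompact Q := isCompact_Icc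
  have hQm : MeasurableSet Q := measurableSet_Icc
  have hdet : ∀ p, |(LinearMap.toContinuousLinearMap (Matrix.toLin'
      ((sphJacobian p).submatrix e.symm id))).det| = p 0 ^ 2 * |Real.cos (p 2)| := by
    intro p
    rw [ContinuousLinearMap.det, LinearMap.coe_toContinuousLinearMap, LinearMap.det_toLin']
    have := Matrix.abs_det_submatrix_equiv_equiv e.symm (Equiv.refl _) (sphJacobian p)
    rw [Equiv.coe_refl] at this
    rw [this, det_sphJacobian, abs_mul, abs_of_nonneg (sq_nonneg _)]
  have hcv := integral_image_eq_integral_abs_det_fderiv_smul volume hQm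
    (fun p _ => (hasFDerivAt_sphChart e p).hasFDerivWithinAt) (injOn_sphChart e hr hb)
    (fun y => g y ^ 2)
  simp only [hdet, smul_eq_mul] at hcv
  have cG : Continuous fun p => g (sphChart e p) ^ 2 := (hg.comp (continuous_sphChart e)).pow 2
  have hp0 : ∀ p ∈ Q, r ≤ p 0 := fun p hp => hp.1 0
  calc r ^ 2 / 3 * ∫ p in Q, g (sphChart e p) ^ 2
      = ∫ p in Q, r ^ 2 / 3 * g (sphChart e p) ^ 2 := (integral_const_mul _ _).symm
    _ ≤ ∫ p in Q, p 0 ^ 2 * |Real.cos (p 2)| * g (sphChart e p) ^ 2 := by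
        refine setIntegral_mono_on ((cG.const_mul _).continuousOn.integrableOn_compact hQc)
          (Continuous.continuousOn (by fun_prop) |>.integrableOn_compact hQc) hQm fun p hp => ?_
        refine mul_le_mul_of_nonneg_right ?_ (sq_nonneg _)
        have h1 := (cos_latitude_ge hb (show b ≤ p 2 from hp.1 2)
          (show p 2 ≤ b + 1 / 4 from hp.2 2)).1
        have h2 : r ^ 2 ≤ p 0 ^ 2 := pow_le_pow_left₀ hr.le (hp0 p hp) 2
        calc r ^ 2 / 3 = r ^ 2 * (1 / 3) := by ring
          _ ≤ p 0 ^ 2 * |Real.cos (p 2)| :=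
            mul_le_mul h2 (h1.trans (le_abs_self _)) (by norm_num) (sq_nonneg _)
    _ = ∫ y in sphChart e '' Q, g y ^ 2 := hcv.symm
    _ ≤ _ := by
        refine setIntegral_mono_set ((hg.pow 2).continuousOn.integrableOn_compact isCompact_Icc)
          (Filter.Eventually.of_forall fun _ => sq_nonneg _) (Filter.Eventually.of_forall ?_)
        rintro _ ⟨p, hp, rfl⟩
        have hu : p 0 ≤ r + 1 / 4 := hp.2 0
        have hle := fun i => abs_le.1
          ((abs_sph_le (hr.le.trans (hp0 p hp)) (e.symm i)).trans hu)
        exact ⟨fun i => (hle i).1, fun i => (hle i).2⟩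

theorem exists_sph_eq {y : Fin 3 → ℝ} {r : ℝ} (hr : 0 < r)
    (hy : y 0 ^ 2 + y 1 ^ 2 + y 2 ^ 2 = r ^ 2) (h2 : y 2 ^ 2 ≤ r ^ 2 / 2) :
    ∃ a b : ℝ, |b| ≤ Real.pi / 4 ∧ sph ![r, a, b] = y := by
  set s := y 2 / r with hs
  have hs2 : s ^ 2 ≤ 1 / 2 := by
    rw [hs, div_pow, div_le_iff₀ (by positivity)]; linarith
  have hsq : |s| ≤ Real.sqrt 2 / 2 := by
    refine abs_le_of_sq_le_sq ?_ (by positivity)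
    nlinarith [Real.sq_sqrt (show (0 : ℝ) ≤ 2 by norm_num)]
  have hs1 : |s| ≤ 1 := abs_le_of_sq_le_sq (by linarith) (by norm_num)
  have hle : ∀ x, x ≤ Real.sqrt 2 / 2 → Real.arcsin x ≤ Real.pi / 4 := fun x hx => by
    refine (Real.arcsin_le_iff_le_sin' ⟨by linarith [Real.pi_pos], by linarith [Real.pi_pos]⟩).2 ?_
    rwa [Real.sin_pi_div_four]
  refine ⟨Complex.arg ⟨y 0, y 1⟩, Real.arcsin s, abs_le.2 ⟨?_, hle s (abs_le.1 hsq).2⟩, ?_⟩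
  · have := hle (-s) (by linarith [(abs_le.1 hsq).1])
    rw [Real.arcsin_neg] at this
    linarith
  have hn : r * Real.cos (Real.arcsin s) = ‖(⟨y 0, y 1⟩ : ℂ)‖ := by
    rw [Real.cos_arcsin, Complex.norm_def, Complex.normSq_mk]
    rw [show r * Real.sqrt (1 - s ^ 2) = Real.sqrt (r ^ 2) * Real.sqrt (1 - s ^ 2) by
      rw [Real.sqrt_sq hr.le], ← Real.sqrt_mul (sq_nonneg r)]
    congr 1
    rw [hs]
    field_simp
    linarith
  funext i
  fin_cases i
  · change r * (Real.cos (Complex.arg ⟨y 0, y 1⟩) * Real.cos (Real.arcsin s)) = y 0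
    rw [mul_left_comm, hn, mul_comm, Complex.norm_mul_cos_arg]
  · change r * (Real.sin (Complex.arg ⟨y 0, y 1⟩) * Real.cos (Real.arcsin s)) = y 1
    rw [mul_left_comm, hn, mul_comm, Complex.norm_mul_sin_arg]
  · change r * Real.sin (Real.arcsin s) = y 2
    rw [Real.sin_arcsin (abs_le.1 hs1).1 (abs_le.1 hs1).2, hs]
    field_simp

theorem exists_sphChart_eq {x : Fin 3 → ℝ} {r : ℝ} (hr : 0 < r)
    (hx : x 0 ^ 2 + x 1 ^ 2 + x 2 ^ 2 = r ^ 2) :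
    ∃ (e : Equiv.Perm (Fin 3)) (a b : ℝ), |b| ≤ Real.pi / 4 ∧ sphChart e ![r, a, b] = x := by
  obtain ⟨k, hk⟩ : ∃ k, x k ^ 2 ≤ r ^ 2 / 2 := by
    by_contra! h
    have h0 := h 0
    have h1 := h 1
    nlinarith [sq_nonneg (x 2)]
  set e := Equiv.swap 2 k with he
  have hsum : x (e 0) ^ 2 + x (e 1) ^ 2 + x (e 2) ^ 2 = r ^ 2 := by
    rw [← hx]
    have := Equiv.sum_comp e fun i => x i ^ 2
    simpa only [Fin.sum_univ_three] using this
  obtain ⟨a, b, hb, h⟩ := exists_sph_eq (y := fun i => x (e i)) hr hsum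
    (by simpa [he] using hk)
  refine ⟨e, a, b, hb, funext fun i => ?_⟩
  rw [sphChart, h]
  exact congrArg x (e.apply_symm_apply i)

/-- Smooth functions on `ℝ³` that are bounded by `M` together with their first derivatives. -/
def BddC1 (M : ℝ) (f : (Fin 3 → ℝ) → ℝ) : Prop :=
  Smooth f ∧ (∀ p, |f p| ≤ M) ∧ ∀ i p, |pd i f p| ≤ M

namespace BddC1

variable {M N : ℝ} {f g : (Fin 3 → ℝ) → ℝ}

theorem mono (hf : BddC1 M f) (h : M ≤ N) : BddC1 N f :=
  ⟨hf.1, fun p => (hf.2.1 p).trans h, fun i p => (hf.2.2 i p).trans h⟩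

theorem const {c : ℝ} (hc : |c| ≤ M) : BddC1 M fun _ => c :=
  ⟨contDiff_const, fun _ => hc, fun i p => by simpa [pd] using (abs_nonneg c).trans hc⟩

theorem add (hf : BddC1 M f) (hg : BddC1 N g) : BddC1 (M + N) fun p => f p + g p :=
  ⟨ContDiff.add hf.1 hg.1, fun p => (abs_add_le _ _).trans (add_le_add (hf.2.1 p) (hg.2.1 p)),
    fun i p => by
      rw [pd_add hf.1 hg.1]
      exact (abs_add_le _ _).trans (add_le_add (hf.2.2 i p) (hg.2.2 i p))⟩

theorem nonneg (hf : BddC1 M f) : 0 ≤ M := (abs_nonneg _).trans (hf.2.1 0)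

theorem mul (hf : BddC1 M f) (hg : BddC1 N g) : BddC1 (2 * (M * N)) fun p => f p * g p := by
  have h : ∀ {x y : ℝ}, |x| ≤ M → |y| ≤ N → |x * y| ≤ M * N := fun hx hy => by
    rw [abs_mul]
    exact mul_le_mul hx hy (abs_nonneg _) hf.nonneg
  refine ⟨ContDiff.mul hf.1 hg.1, fun p => ?_, fun i p => ?_⟩
  · linarith [h (hf.2.1 p) (hg.2.1 p), mul_nonneg hf.nonneg hg.nonneg]
  · rw [pd_mul (hf.1.differentiable p) (hg.1.differentiable p)]
    refine (abs_add_le _ _).trans ?_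
    linarith [h (hf.2.2 i p) (hg.2.1 p), h (hf.2.1 p) (hg.2.2 i p)]

theorem cos_coord (j : Fin 3) : BddC1 1 fun p => Real.cos (p j) := by
  refine ⟨(smooth_coord j).cos, fun p => Real.abs_cos_le_one _, fun i p => ?_⟩
  have h : HasFDerivAt (fun p : Fin 3 → ℝ => p j)
    (ContinuousLinearMap.proj (R := ℝ) (φ := fun _ : Fin 3 => ℝ) j) p :=
    (ContinuousLinearMap.proj (R := ℝ) (φ := fun _ : Fin 3 => ℝ) j).hasFDerivAt
  simp only [pd, h.cos.fderiv]
  by_cases hij : j = i <;> simp [hij, Real.abs_sin_le_one]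

theorem sin_coord (j : Fin 3) : BddC1 1 fun p => Real.sin (p j) := by
  refine ⟨(smooth_coord j).sin, fun p => Real.abs_sin_le_one _, fun i p => ?_⟩
  have h : HasFDerivAt (fun p : Fin 3 → ℝ => p j)
    (ContinuousLinearMap.proj (R := ℝ) (φ := fun _ : Fin 3 => ℝ) j) p :=
    (ContinuousLinearMap.proj (R := ℝ) (φ := fun _ : Fin 3 => ℝ) j).hasFDerivAt
  simp only [pd, h.sin.fderiv]
  by_cases hij : j = i <;> simp [hij, Real.abs_cos_le_one]

end BddC1

theorem exists_rotation_eq_sum (i j : Fin 3) : ∃ κ : Fin 10 → ℝ, (∀ l, |κ l| ≤ 1) ∧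
    ∀ (u : (Fin 4 → ℝ) → ℝ) (z : Fin 4 → ℝ),
      z i.succ * pd j.succ u z - z j.succ * pd i.succ u z = ∑ l, κ l * GammaField l u z := by
  have key : ∀ (s : ℝ) (l : Fin 10) (i j : Fin 3), |s| ≤ 1 →
      (∀ (u : (Fin 4 → ℝ) → ℝ) (z : Fin 4 → ℝ),
        z i.succ * pd j.succ u z - z j.succ * pd i.succ u z = s * GammaField l u z) →
      ∃ κ : Fin 10 → ℝ, (∀ l, |κ l| ≤ 1) ∧ ∀ (u : (Fin 4 → ℝ) → ℝ) (z : Fin 4 → ℝ),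
        z i.succ * pd j.succ u z - z j.succ * pd i.succ u z = ∑ l, κ l * GammaField l u z := by
    intro s l i j hs h
    refine ⟨fun m => if m = l then s else 0, fun m => ?_, fun u z => ?_⟩
    · beta_reduce
      split_ifs <;> simp [hs]
    · simp [h]
  have pos : ∀ (l : Fin 10) (i j : Fin 3), (∀ (u : (Fin 4 → ℝ) → ℝ) (z : Fin 4 → ℝ),
      z i.succ * pd j.succ u z - z j.succ * pd i.succ u z = GammaField l u z) → _ :=
    fun l i j h => key 1 l i j (by simp) fun u z => by rw [h, one_mul]
  have neg : ∀ (l : Fin 10) (i j : Fin 3), (∀ (u : (Fin 4 → ℝ) → ℝ) (z : Fin 4 → ℝ),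
      z j.succ * pd i.succ u z - z i.succ * pd j.succ u z = GammaField l u z) → _ :=
    fun l i j h => key (-1) l i j (by simp) fun u z => by rw [← h]; ring
  have same := fun i : Fin 3 => key 0 0 i i (by simp) fun u z => by ring
  fin_cases i <;> fin_cases j
  · exact same 0
  · exact pos 4 0 1 fun _ _ => rfl
  · exact pos 5 0 2 fun _ _ => rfl
  · exact neg 4 1 0 fun _ _ => rfl
  · exact same 1
  · exact pos 6 1 2 fun _ _ => rfl
  · exact neg 5 2 0 fun _ _ => rfl
  · exact neg 6 2 1 fun _ _ => rfl
  · exact same 2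

theorem smooth_cons_sphChart (e : Equiv.Perm (Fin 3)) (t : ℝ) (k : Fin 4) :
    Smooth fun p => (Fin.cons t (sphChart e p) : Fin 4 → ℝ) k := by
  refine Fin.cases ?_ (fun j => ?_) k
  · exact contDiff_const
  · exact smooth_sph (e.symm j)

theorem pd_comp_sphChart {u : (Fin 4 → ℝ) → ℝ} (hu : Smooth u) (e : Equiv.Perm (Fin 3)) (t : ℝ)
    (j : Fin 3) (p : Fin 3 → ℝ) :
    pd j (fun p => u (Fin.cons t (sphChart e p))) p =
      ∑ i, sphJacobian p i j * pd (e i).succ u (Fin.cons t (sphChart e p)) := by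
  rw [pd_comp_map hu (smooth_cons_sphChart e t), Fin.sum_univ_succ]
  have h0 : pd j (fun p => (Fin.cons t (sphChart e p) : Fin 4 → ℝ) 0) p = 0 := by
    simp [pd]
  have hs : ∀ k : Fin 3, pd j (fun p => (Fin.cons t (sphChart e p) : Fin 4 → ℝ) k.succ) p =
      sphJacobian p (e.symm k) j := fun k => pd_sphChart e k j p
  rw [h0, zero_mul, zero_add, ← Equiv.sum_comp e]
  simp only [hs, Equiv.symm_apply_apply]

/-- In spherical coordinates, coordinate derivatives are bounded combinations of the fields. -/
theorem exists_pd_comp_sphChart (e : Equiv.Perm (Fin 3)) :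
    ∃ c : Fin 3 → Fin 10 → (Fin 3 → ℝ) → ℝ, (∀ j l, BddC1 6 (c j l)) ∧
      ∀ (t : ℝ) (u : (Fin 4 → ℝ) → ℝ), Smooth u → ∀ j,
        pd j (fun p => u (Fin.cons t (sphChart e p))) =
          fun p => ∑ l, c j l p * GammaField l u (Fin.cons t (sphChart e p)) := by
  obtain ⟨κ, hκ, h01⟩ := exists_rotation_eq_sum (e 0) (e 1)
  obtain ⟨κ', hκ', h02⟩ := exists_rotation_eq_sum (e 0) (e 2)
  obtain ⟨κ'', hκ'', h12⟩ := exists_rotation_eq_sum (e 1) (e 2)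
  set tr : Fin 3 → Fin 10 := fun i => Fin.castLE (by norm_num) (e i).succ with htr
  set ω : Fin 3 → (Fin 3 → ℝ) → ℝ := ![fun p => Real.cos (p 1) * Real.cos (p 2),
    fun p => Real.sin (p 1) * Real.cos (p 2), fun p => Real.sin (p 2)] with hω
  have bω : ∀ i, BddC1 2 (ω i) := by
    intro i
    fin_cases i
    · exact ((BddC1.cos_coord 1).mul (BddC1.cos_coord 2)).mono (by norm_num)
    · exact ((BddC1.sin_coord 1).mul (BddC1.cos_coord 2)).mono (by norm_num)
    · exact (BddC1.sin_coord 2).mono (by norm_num)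
  have bδ : ∀ i l, BddC1 2 fun p => if l = tr i then ω i p else 0 := by
    intro i l
    by_cases h : l = tr i
    · simpa only [h, if_true] using bω i
    · simpa only [h, if_false] using BddC1.const (M := 2) (c := 0) (by simp)
  refine ⟨![fun l p => (if l = tr 0 then ω 0 p else 0) + (if l = tr 1 then ω 1 p else 0) +
    (if l = tr 2 then ω 2 p else 0), fun l _ => κ l,
    fun l p => Real.cos (p 1) * κ' l + Real.sin (p 1) * κ'' l], fun j l => ?_,
    fun t u hu j => funext fun p => ?_⟩
  · fin_cases j
    · exact (((bδ 0 l).add (bδ 1 l)).add (bδ 2 l)).mono (by norm_num)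
    · exact BddC1.const ((hκ l).trans (by norm_num))
    · exact (((BddC1.cos_coord 1).mul (BddC1.const (hκ' l))).add
        ((BddC1.sin_coord 1).mul (BddC1.const (hκ'' l)))).mono (by norm_num)
  · rw [pd_comp_sphChart hu]
    set z : Fin 4 → ℝ := Fin.cons t (sphChart e p) with hz
    have hzi : ∀ i, z (e i).succ = sph p i := fun i => by
      simp [hz, sphChart]
    have z0 : z (e 0).succ = p 0 * (Real.cos (p 1) * Real.cos (p 2)) := hzi 0
    have z1 : z (e 1).succ = p 0 * (Real.sin (p 1) * Real.cos (p 2)) := hzi 1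
    have z2 : z (e 2).succ = p 0 * Real.sin (p 2) := hzi 2
    fin_cases j
    · have htu : ∀ i, GammaField (tr i) u z = pd (e i).succ u z := fun i => by
        rw [htr, gammaField_translation]
      simp only [Fin.sum_univ_three, Fin.zero_eta, Matrix.cons_val_zero, add_mul,
        Finset.sum_add_distrib, ite_mul, zero_mul, Finset.sum_ite_eq', Finset.mem_univ, if_true,
        htu]
      simp [sphJacobian, hω]
    · have h := h01 u z
      rw [z0, z1] at h
      simp only [Fin.mk_one, Matrix.cons_val_one]
      simp only [Matrix.cons_val_zero]
      rw [← h]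
      simp [sphJacobian, Fin.sum_univ_three]
      ring
    · have h := h02 u z
      have h' := h12 u z
      rw [z0, z2] at h
      rw [z1, z2] at h'
      simp only [Fin.reduceFinMk, Matrix.cons_val, add_mul, Finset.sum_add_distrib, mul_assoc]
      rw [← Finset.mul_sum, ← Finset.mul_sum, ← h, ← h']
      simp [sphJacobian, Fin.sum_univ_three]
      linear_combination (-(p 0 * Real.cos (p 2) * pd (e 2).succ u z)) *
        Real.sin_sq_add_cos_sq (p 1)

section Exterior

variable {w : (Fin 4 → ℝ) → ℝ}

theorem abs_sum_mul_le_card {c f : Fin 10 → ℝ} {M N : ℝ} (hc : ∀ l, |c l| ≤ M)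
    (hf : ∀ l, |f l| ≤ N) :
    |∑ l, c l * f l| ≤ 10 * (M * N) := by
  refine (Finset.abs_sum_le_sum_abs _ _).trans
    ((Finset.sum_le_card_nsmul _ _ (M * N) fun ν _ => ?_).trans (by simp))
  rw [abs_mul]
  exact mul_le_mul (hc ν) (hf ν) (abs_nonneg _) ((abs_nonneg _).trans (hc ν))

theorem abs_pd_comp_sphChart_le (hw : Smooth w) (e : Equiv.Perm (Fin 3)) (t : ℝ) (μ : Fin 4)
    (j : Fin 3) (p : Fin 3 → ℝ) :
    |pd j (fun p => pd μ w (Fin.cons t (sphChart e p))) p| ≤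
      300 * gradSum w (Fin.cons t (sphChart e p)) := by
  obtain ⟨c, hc, h⟩ := exists_pd_comp_sphChart e
  rw [h t _ (hw.pd μ) j]
  refine (abs_sum_mul_le_card (fun l => (hc j l).2.1 p)
    fun l => abs_gammaField_pd_le hw l μ _).trans (by linarith)

theorem abs_pd_pd_comp_sphChart_le (hw : Smooth w) (e : Equiv.Perm (Fin 3)) (t : ℝ) (μ : Fin 4)
    (i j : Fin 3) (p : Fin 3 → ℝ) :
    |pd i (pd j (fun p => pd μ w (Fin.cons t (sphChart e p)))) p| ≤
      90300 * gradSum w (Fin.cons t (sphChart e p)) := by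
  obtain ⟨c, hc, h⟩ := exists_pd_comp_sphChart e
  have hs : ∀ l, Smooth fun p => GammaField l (pd μ w) (Fin.cons t (sphChart e p)) := fun l =>
    ((hw.pd μ).gammaField l).comp_map (smooth_cons_sphChart e t)
  have hm : ∀ l, Smooth fun p => c j l p * GammaField l (pd μ w) (Fin.cons t (sphChart e p)) :=
    fun l => ContDiff.mul (hc j l).1 (hs l)
  rw [h t _ (hw.pd μ) j, pd_sum _ hm]
  have he : ∀ l, pd i (fun p => c j l p * GammaField l (pd μ w) (Fin.cons t (sphChart e p))) p =
      pd i (c j l) p * GammaField l (pd μ w) (Fin.cons t (sphChart e p)) +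
      c j l p * pd i (fun p => GammaField l (pd μ w) (Fin.cons t (sphChart e p))) p := fun l => by
    rw [pd_mul ((hc j l).1.differentiable p) ((hs l).differentiable p)]
  simp only [he, Finset.sum_add_distrib]
  have h1 := abs_sum_mul_le_card (fun l => (hc j l).2.2 i p) fun l =>
    abs_gammaField_pd_le hw l μ (Fin.cons t (sphChart e p))
  have h2 := abs_sum_mul_le_card (f := fun l =>
    pd i (fun p => GammaField l (pd μ w) (Fin.cons t (sphChart e p))) p)
    (fun l => (hc j l).2.1 p) fun l => by
      rw [h t _ ((hw.pd μ).gammaField l) i]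
      exact abs_sum_mul_le_card (fun m => (hc i m).2.1 p) fun m =>
        abs_gammaField_gammaField_pd_le hw m l μ (Fin.cons t (sphChart e p))
  exact (abs_add_le _ _).trans (by linarith)

theorem continuous_gradSum_sphChart (hw : Smooth w) (e : Equiv.Perm (Fin 3)) (t : ℝ) :
    Continuous fun p => gradSum w (Fin.cons t (sphChart e p)) :=
  continuous_finsetSum _ fun _ _ =>
    (((hw.opIter _).pd _).comp_map (smooth_cons_sphChart e t)).continuous.abs

theorem exterior_estimate {B : ℝ} (hB : 0 < B) : ∃ C : ℝ, 0 ≤ C ∧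
    ∀ w : (Fin 4 → ℝ) → ℝ, Smooth w → (∀ z : Fin 4 → ℝ, z 0 ≤ 2*B → w z = 0) →
      (∀ z : Fin 4 → ℝ, rad z > z 0 - B → Box w z = 0) → ∀ t : ℝ, 2*B ≤ t →
      ∀ x : Fin 3 → ℝ, t / 2 ≤ rad (Fin.cons t x) → ∀ μ : Fin 4,
        t * |pd μ w (Fin.cons t x)| ≤ C * dyadicSum (Box w) B t := by
  obtain ⟨K, eK⟩ : ∃ K : ℝ, K = ((Fintype.card (Word × Fin 4) : ℕ) : ℝ) := ⟨_, rfl⟩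
  have hK : 0 ≤ K := eK ▸ Nat.cast_nonneg _
  obtain ⟨A, hA⟩ : ∃ A : ℝ, A = (1 / 4) ^ (-(3 / 2) : ℝ) + 3 * (1 / 4) ^ (-(1 / 2) : ℝ) * 900 +
    2 * (1 / 4) ^ (1 / 2 : ℝ) * 812700 := ⟨_, rfl⟩
  have hA0 : 0 ≤ A := by rw [hA]; positivity
  refine ⟨16 * K * A, by positivity, ?_⟩
  intro w hw hvan hsupp t hBt x hx μ
  have ht : 0 < t := by linarith
  set D := dyadicSum (Box w) B t with hD
  have hD0 : 0 ≤ D := dyadicSum_nonneg _ _ _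
  set r := rad (Fin.cons t x) with hr
  have hr0 : 0 < r := by linarith
  have hrsq : x 0 ^ 2 + x 1 ^ 2 + x 2 ^ 2 = r ^ 2 := by
    rw [hr, rad_cons, Real.sq_sqrt (by positivity)]
  obtain ⟨e, a, b, hb, hp⟩ := exists_sphChart_eq hr0 hrsq
  set P : Fin 3 → ℝ := ![r, a, b] with hP
  set Q := Set.Icc P fun i => P i + 1 / 4 with hQ
  have hQc : IsCompact Q := isCompact_Icc
  set G : (Fin 3 → ℝ) → ℝ := fun p => gradSum w (Fin.cons t (sphChart e p)) with hG
  have cG : Continuous G := continuous_gradSum_sphChart hw e t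
  have hG0 : ∀ p, 0 ≤ G p := fun p => gradSum_nonneg _ _
  set M : ℝ := 8 * K * D / r with hM
  have hM0 : 0 ≤ M := by positivity
  have iG : ∫ p in Q, G p ^ 2 ≤ M ^ 2 := by
    have h1 := integral_sphChart_sq_le e (continuous_gradSum_slice hw t) (a := a) hr0 hb
    have h2 := integral_gradSum_sq_le hw hB hBt hvan hsupp (R := r + 1 / 4) (by linarith)
    rw [← eK] at h2
    have h3 : r ^ 2 / 3 * ∫ p in Q, G p ^ 2 ≤ (K * (4 * D)) ^ 2 := h1.trans h2
    rw [hM, div_pow, le_div_iff₀ (by positivity)]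
    nlinarith [sq_nonneg (K * D)]
  have bound : ∀ (f : (Fin 3 → ℝ) → ℝ) (k : ℝ), Continuous f → (∀ y, 0 ≤ f y) →
      (∀ y, f y ≤ k * G y) → ∫ y in Q, f y ^ 2 ≤ (k * M) ^ 2 := by
    intro f k hf hf0 hle
    calc ∫ y in Q, f y ^ 2 ≤ ∫ y in Q, k ^ 2 * G y ^ 2 := by
          refine integral_mono ((hf.pow 2).continuousOn.integrableOn_compact hQc)
            (((cG.pow 2).const_mul _).continuousOn.integrableOn_compact hQc) fun y => ?_
          beta_reduce
          rw [← mul_pow]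
          exact pow_le_pow_left₀ (hf0 y) (hle y) 2
      _ ≤ k ^ 2 * M ^ 2 := by rw [integral_const_mul]; gcongr
      _ = _ := by ring
  set V : (Fin 3 → ℝ) → ℝ := fun p => pd μ w (Fin.cons t (sphChart e p)) with hVdef
  have hV : Smooth V := (hw.pd μ).comp_map (smooth_cons_sphChart e t)
  have h₀ : ∫ y in Q, |V y| ^ 2 ≤ (1 * M) ^ 2 := by
    refine bound _ 1 hV.continuous.abs (fun y => abs_nonneg _) fun y => ?_
    rw [one_mul]
    exact abs_pd_opIter_le_gradSum w (L := []) (by simp) μ _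
  have h₁ : ∫ y in Q, (∑ i, |pd i V y|) ^ 2 ≤ (900 * M) ^ 2 := by
    refine bound _ 900 (continuous_finsetSum _ fun i _ => (hV.pd i).continuous.abs)
      (fun y => Finset.sum_nonneg fun _ _ => abs_nonneg _) fun y => ?_
    exact (Finset.sum_le_card_nsmul _ _ (300 * G y) fun i _ =>
      abs_pd_comp_sphChart_le hw e t μ i y).trans (by simp; linarith)
  have h₂ : ∫ y in Q, (∑ i, ∑ j, |pd j (pd i V) y|) ^ 2 ≤ (812700 * M) ^ 2 := by
    refine bound _ 812700 (continuous_finsetSum _ fun i _ => continuous_finsetSum _ fun j _ =>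
      ((hV.pd i).pd j).continuous.abs)
      (fun y => Finset.sum_nonneg fun _ _ => Finset.sum_nonneg fun _ _ => abs_nonneg _)
      fun y => ?_
    refine (Finset.sum_le_card_nsmul _ _ (3 * (90300 * G y)) fun i _ => ?_).trans
      (by simp; linarith)
    exact (Finset.sum_le_card_nsmul _ _ (90300 * G y) fun j _ =>
      abs_pd_pd_comp_sphChart_le hw e t μ j i y).trans (by simp)
  have key := sobolev_cube hV P (a := 1 / 4) (R := 1 / 4) (by norm_num) le_rfl
    (mul_nonneg (by norm_num) hM0)
    (mul_nonneg (by norm_num) hM0) (mul_nonneg (by norm_num) hM0) h₀ h₁ h₂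
  have hVP : V P = pd μ w (Fin.cons t x) := by rw [hVdef]; simp only [hp]
  have hVx : |pd μ w (Fin.cons t x)| ≤ A * M := by
    rw [← hVP]
    refine key.trans (le_of_eq ?_)
    rw [hA]
    ring
  have hrM : r * M = 8 * K * D := by rw [hM]; field_simp
  calc t * |pd μ w (Fin.cons t x)| ≤ (2 * r) * (A * M) :=
        mul_le_mul (by linarith) hVx (abs_nonneg _) (by linarith)
    _ = 2 * A * (r * M) := by ring
    _ = _ := by rw [hrM]; ring

end Exterior

/-- decay estimate for the wave equation: fix `B > 0`.  There is a constant
`C` such that if `w ∈ C^∞(ℝ×ℝ³)` satisfies `w(t,x)=0` for `t ≤ 2B` and `□w(t,x)=0` for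
`|x| > t-B`, then for all `t ≥ 2B`,
`(1+t) sup_x |∂_{t,x} w(t,x)| ≤ C Σ_{|α|≤2} Σ_k sup_{τ∈[2^{k-1},2^{k+1}]∩[2B,t]} 2^k ‖Γ^α □w(τ,·)‖₂`. -/
theorem stmt10 (B : ℝ) (hB : 0 < B) :
    ∃ C : ℝ, 0 < C ∧
      ∀ w : (Fin 4 → ℝ) → ℝ, ContDiff ℝ (⊤ : ℕ∞) w →
        (∀ z : Fin 4 → ℝ, z 0 ≤ 2*B → w z = 0) →
        (∀ z : Fin 4 → ℝ, rad z > z 0 - B → Box w z = 0) →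
        ∀ t : ℝ, 2*B ≤ t → ∀ x : Fin 3 → ℝ, ∀ i : Fin 4,
          (1 + t) * |pd i w (Fin.cons t x)| ≤
            C * ∑ n ∈ Finset.range 3, ∑ σ : Fin n → Fin 10,
              dyadic (L2x (opIter GammaField (List.ofFn σ) (Box w))) B t := by
  obtain ⟨C₁, hC₁, h₁⟩ := interior_estimate hB
  obtain ⟨C₂, hC₂, h₂⟩ := exterior_estimate hB
  refine ⟨(1 / (2 * B) + 1) * (C₁ + C₂ + 1), by positivity, fun w hw hvan hsupp t hBt x i => ?_⟩
  change _ ≤ _ * dyadicSum (Box w) B t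
  have hD0 := dyadicSum_nonneg (Box w) B t
  have ht : t * |pd i w (Fin.cons t x)| ≤ (C₁ + C₂ + 1) * dyadicSum (Box w) B t := by
    rcases le_total (rad (Fin.cons t x)) (t / 2) with h | h
    · nlinarith [h₁ w hw hvan hsupp t hBt x h i]
    · nlinarith [h₂ w hw hvan hsupp t hBt x h i]
  have h1t : 1 + t ≤ (1 / (2 * B) + 1) * t := by
    have : 1 ≤ 1 / (2 * B) * t := by rw [one_div_mul_eq_div, le_div_iff₀ (by linarith)]; linarith
    linarith
  calc (1 + t) * |pd i w (Fin.cons t x)| ≤ (1 / (2 * B) + 1) * t * |pd i w (Fin.cons t x)| :=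
        mul_le_mul_of_nonneg_right h1t (abs_nonneg _)
    _ = (1 / (2 * B) + 1) * (t * |pd i w (Fin.cons t x)|) := by ring
    _ ≤ (1 / (2 * B) + 1) * ((C₁ + C₂ + 1) * dyadicSum (Box w) B t) :=
        mul_le_mul_of_nonneg_left ht (by positivity)
    _ = _ := by ring
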